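/- Let 𝒢 ~ 𝒢(n, λ/n). (1) If 0 < λ < 1, there exist constants γ = γ(λ) > 0 and K > 0 such that for all n, |E[Σ_{j≥1} L_j(𝒢)²] − γn| ≤ K and Var[Σ_{j≥1} L_j(𝒢)²] ≤ K·n. (2) If λ > 1, there exist constants γ = γ(λ) > 0 and K > 0 such that for all n, |E[Σ_{j≥2} L_j(𝒢)²] − γn| ≤ K and Var[Σ_{j≥2} L_j(𝒢)²] ≤ K·n. -/

import Mathlib

open scoped Classical
open Finset

/-- Spin configurations on `n` vertices with `q` spins. -/
abbrev Conf (n q : ℕ) := Fin n → Fin q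

/-- Number of vertices assigned spin `j`. -/
def cntN {n q : ℕ} (X : Conf n q) (j : Fin q) : ℕ :=
  (Finset.univ.filter (fun v => X v = j)).card

/-- Number of monochromatic pairs `{u,v}` (`u < v`, same spin). -/
def numMono {n q : ℕ} (σ : Conf n q) : ℕ :=
  (Finset.univ.filter (fun p : Fin n × Fin n => p.1 < p.2 ∧ σ p.1 = σ p.2)).card

/-- The mean-field `q`-state Potts measure: probability of `σ`. -/
noncomputable def pottsProb (n q : ℕ) (β : ℝ) (σ : Conf n q) : ℝ :=
  Real.exp (β / n * numMono σ) / ∑ τ : Conf n q, Real.exp (β / n * numMono τ)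

/-- The set of monochromatic pairs of a configuration. -/
def monoPairs {n q : ℕ} (σ : Conf n q) : Finset (Fin n × Fin n) :=
  Finset.univ.filter (fun p : Fin n × Fin n => p.1 < p.2 ∧ σ p.1 = σ p.2)

/-- The graph on `Fin n` whose edges are the pairs in `E`. -/
def graphOf {n : ℕ} (E : Finset (Fin n × Fin n)) : SimpleGraph (Fin n) :=
  SimpleGraph.fromRel (fun u v => (u, v) ∈ E)

/-- Number of connected components of the graph `(V, E)`. -/
noncomputable def numComps {n : ℕ} (E : Finset (Fin n × Fin n)) : ℕ :=
  Nat.card (graphOf E).ConnectedComponent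

/-- One-step transition probability of the Swendsen–Wang dynamics:
percolate on monochromatic pairs with probability `p = 1 - exp (-β/n)`,
then color each connected component uniformly at random. -/
noncomputable def swStep (n q : ℕ) (β : ℝ) (σ τ : Conf n q) : ℝ :=
  ∑ E ∈ (monoPairs σ).powerset,
    ((1 - Real.exp (-(β / n))) ^ E.card *
        Real.exp (-(β / n)) ^ ((monoPairs σ).card - E.card)) *
      (if ∀ u v : Fin n, (graphOf E).Reachable u v → τ u = τ v then
        ((q : ℝ))⁻¹ ^ numComps E else 0)

/-- `t`-step transition probability of the Swendsen–Wang dynamics. -/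
noncomputable def swProb (n q : ℕ) (β : ℝ) : ℕ → Conf n q → Conf n q → ℝ
  | 0, σ, τ => if σ = τ then 1 else 0
  | t + 1, σ, τ => ∑ η : Conf n q, swStep n q β σ η * swProb n q β t η τ

/-- Probability of observing the trajectory `ω 0, ω 1, …, ω (ℓ-1)` at times
`1, …, ℓ` for the SW dynamics started at `X₀`. -/
noncomputable def pathProb (n q : ℕ) (β : ℝ) (X₀ : Conf n q) (ℓ : ℕ)
    (ω : Fin ℓ → Conf n q) : ℝ :=
  ∏ i : Fin ℓ, swStep n q β
    (if _h : 0 < (i : ℕ) then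
        ω ⟨(i : ℕ) - 1, lt_of_le_of_lt (Nat.sub_le _ _) i.isLt⟩
      else X₀) (ω i)

/-- Total variation distance between two probability vectors on configurations. -/
noncomputable def tvDist {n q : ℕ} (f g : Conf n q → ℝ) : ℝ :=
  (∑ τ : Conf n q, |f τ - g τ|) / 2

/-- Mixing time `τ_mix(ε)` of the SW dynamics. -/
noncomputable def mixingTime (n q : ℕ) (β ε : ℝ) : ℕ :=
  sInf {t : ℕ | ∀ σ : Conf n q, tvDist (swProb n q β t σ) (pottsProb n q β) ≤ ε}

/-- `theta lam` is the unique root in `(0,1)` of `exp (-lam * x) = 1 - x`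
for `lam > 1`, and `0` for `lam ≤ 1`. -/
noncomputable def theta (lam : ℝ) : ℝ :=
  if lam ≤ 1 then 0
  else sSup {x : ℝ | x ∈ Set.Ioo (0 : ℝ) 1 ∧ Real.exp (-lam * x) = 1 - x}

/-- The drift function `F`. -/
noncomputable def F (q : ℕ) (β : ℝ) (x : ℝ) : ℝ :=
  1 / q + (1 - 1 / q) * theta (β * x) * x

/-- The unique fixed point of `F` in `(1/q, 1]` (for `β > q`). -/
noncomputable def aFix (q : ℕ) (β : ℝ) : ℝ :=
  sSup {x : ℝ | x ∈ Set.Ioc (1 / (q : ℝ)) 1 ∧ F q β x = x}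

/-- The cutoff constant `c(β,q) = (2 log (1 / F'(a)))⁻¹`. -/
noncomputable def cConst (q : ℕ) (β : ℝ) : ℝ :=
  (2 * Real.log (1 / deriv (F q β) (aFix q β)))⁻¹

/-- Fraction of vertices assigned spin `j`. -/
noncomputable def cntFrac {n q : ℕ} (X : Conf n q) : Fin q → ℝ :=
  fun j => (cntN X j : ℝ) / n

/-- The proportions vector `α(X)`: fractions of vertices of each spin,
sorted in nonincreasing order. -/
noncomputable def alphaVec {n q : ℕ} (X : Conf n q) : Fin q → ℝ :=
  fun i => cntFrac X (Tuple.sort (cntFrac X) i.rev)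

/-- `ℓ∞` distance between two vectors indexed by `Fin q`. -/
noncomputable def linf {q : ℕ} (f g : Fin q → ℝ) : ℝ :=
  ⨆ i : Fin q, |f i - g i|

/-- The vector `κ(b) = (b, (1-b)/(q-1), …, (1-b)/(q-1))`. -/
noncomputable def kappaVec (q : ℕ) (b : ℝ) : Fin q → ℝ :=
  fun i => if (i : ℕ) = 0 then b else (1 - b) / ((q : ℝ) - 1)

/-- The majority vector `m = (a, (1-a)/(q-1), …, (1-a)/(q-1))`. -/
noncomputable def mVec (q : ℕ) (β : ℝ) : Fin q → ℝ :=
  kappaVec q (aFix q β)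

/-- Index of the most common spin of `X` (least such index on ties). -/
noncomputable def domIdx {n q : ℕ} (X : Conf n q) : ℕ :=
  sInf {j : ℕ | ∃ hj : j < q, ∀ j' : Fin q, cntN X j' ≤ cntN X ⟨j, hj⟩}

/-- `α₁(X)`: fraction of vertices carrying the most common spin of `X`. -/
noncomputable def alpha1 {n q : ℕ} (X : Conf n q) : ℝ :=
  ((Finset.univ.filter (fun v : Fin n => (X v : ℕ) = domIdx X)).card : ℝ) / n

/-- `α_{1,k}(X)`: fraction of vertices of `Vk` carrying the most common spin of `X`. -/
noncomputable def alpha1In {n q : ℕ} (X : Conf n q) (Vk : Finset (Fin n)) : ℝ :=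
  ((Vk.filter (fun v => (X v : ℕ) = domIdx X)).card : ℝ) / Vk.card

/-- `P` is a partition of the vertex set into `q` classes. -/
def IsPartition {n q : ℕ} (P : Fin q → Finset (Fin n)) : Prop :=
  (∀ i j, i ≠ j → Disjoint (P i) (P j)) ∧ ∀ v : Fin n, ∃ i, v ∈ P i

/-- A `λ`-partition: a partition with all classes of size at least `λ n`. -/
def IsLamPartition {n q : ℕ} (lam : ℝ) (P : Fin q → Finset (Fin n)) : Prop :=
  IsPartition P ∧ ∀ i, lam * n ≤ ((P i).card : ℝ)

/-- Projection: `projCnt P X i j` is the number of vertices of `P i`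
assigned spin `j` in `X`. -/
def projCnt {n q : ℕ} (P : Fin q → Finset (Fin n)) (X : Conf n q) :
    Fin q → Fin q → ℕ :=
  fun i j => ((P i).filter (fun v => X v = j)).card

/-- All potential edges of the complete graph on `Fin n`. -/
def allPairs (n : ℕ) : Finset (Fin n × Fin n) :=
  Finset.univ.filter (fun p : Fin n × Fin n => p.1 < p.2)

/-- Probability of the edge set `E` under the Erdős–Rényi measure `G(n,p)`. -/
noncomputable def erProb (n : ℕ) (p : ℝ) (E : Finset (Fin n × Fin n)) : ℝ :=
  p ^ E.card * (1 - p) ^ ((allPairs n).card - E.card)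

/-- Size of the connected component of `v` in the graph `(V, E)`. -/
noncomputable def compCard {n : ℕ} (E : Finset (Fin n × Fin n)) (v : Fin n) : ℕ :=
  (Finset.univ.filter (fun u => (graphOf E).Reachable v u)).card

/-- `L₁`: size of the largest connected component. -/
noncomputable def L1 {n : ℕ} (E : Finset (Fin n × Fin n)) : ℕ :=
  Finset.univ.sup (fun v => compCard E v)

/-- Sum of the squares of the component sizes, `Σ_j L_j²`
(computed as `Σ_v |C(v)|`). -/
noncomputable def sumCompSq {n : ℕ} (E : Finset (Fin n × Fin n)) : ℕ :=
  ∑ v : Fin n, compCard E v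

/-- Expectation of `f` under the Erdős–Rényi measure `G(n,p)`. -/
noncomputable def erExp (n : ℕ) (p : ℝ) (f : Finset (Fin n × Fin n) → ℝ) : ℝ :=
  ∑ E ∈ (allPairs n).powerset, erProb n p E * f E

/-- Random-cluster weight of an edge set with parameters `q`, `p = 1 - exp (-β/n)`. -/
noncomputable def rcWeight (n q : ℕ) (β : ℝ) (E : Finset (Fin n × Fin n)) : ℝ :=
  (1 - Real.exp (-(β / n))) ^ E.card *
    Real.exp (-(β / n)) ^ ((allPairs n).card - E.card) * (q : ℝ) ^ numComps E

/-- The mean-field random-cluster measure: probability of the edge set `E`. -/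
noncomputable def rcProb (n q : ℕ) (β : ℝ) (E : Finset (Fin n × Fin n)) : ℝ :=
  rcWeight n q β E / ∑ B ∈ (allPairs n).powerset, rcWeight n q β B

/-! ### Bernoulli percolation on a finite set -/

/-- Expectation of `f` of a random subset of `P` containing each element independently with
probability `p`. -/
noncomputable def perc {ε : Type*} (p : ℝ) (P : Finset ε) (f : Finset ε → ℝ) : ℝ :=
  ∑ E ∈ P.powerset, p ^ E.card * (1 - p) ^ (P.card - E.card) * f E

section perc
variable {ε : Type*} {p : ℝ} {P : Finset ε}

lemma perc_congr {f g : Finset ε → ℝ} (h : ∀ E ⊆ P, f E = g E) :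
    perc p P f = perc p P g :=
  Finset.sum_congr rfl fun E hE => by rw [h E (Finset.mem_powerset.1 hE)]

lemma perc_const (c : ℝ) : perc p P (fun _ => c) = c := by
  unfold perc
  rw [← Finset.sum_mul, Finset.sum_pow_mul_eq_add_pow]
  simp

lemma perc_add (f g : Finset ε → ℝ) :
    perc p P (fun E => f E + g E) = perc p P f + perc p P g := by
  simp only [perc, mul_add, Finset.sum_add_distrib]

lemma perc_sub (f g : Finset ε → ℝ) :
    perc p P (fun E => f E - g E) = perc p P f - perc p P g := by
  simp only [perc, mul_sub, Finset.sum_sub_distrib]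

lemma perc_const_mul (c : ℝ) (f : Finset ε → ℝ) :
    perc p P (fun E => c * f E) = c * perc p P f := by
  simp only [perc, Finset.mul_sum]
  exact Finset.sum_congr rfl fun E _ => by ring

lemma perc_mul_const (c : ℝ) (f : Finset ε → ℝ) :
    perc p P (fun E => f E * c) = perc p P f * c := by
  simp only [mul_comm _ c, perc_const_mul]

lemma perc_sum {ι : Type*} (s : Finset ι) (f : ι → Finset ε → ℝ) :
    perc p P (fun E => ∑ i ∈ s, f i E) = ∑ i ∈ s, perc p P (f i) := by
  simp only [perc, Finset.mul_sum]
  exact Finset.sum_comm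

lemma perc_mono (hp : 0 ≤ p) (hp1 : p ≤ 1) {f g : Finset ε → ℝ} (h : ∀ E ⊆ P, f E ≤ g E) :
    perc p P f ≤ perc p P g := by
  refine Finset.sum_le_sum fun E hE => ?_
  have : 0 ≤ 1 - p := by linarith
  exact mul_le_mul_of_nonneg_left (h E (Finset.mem_powerset.1 hE)) (by positivity)

lemma perc_nonneg (hp : 0 ≤ p) (hp1 : p ≤ 1) {f : Finset ε → ℝ} (h : ∀ E ⊆ P, 0 ≤ f E) :
    0 ≤ perc p P f := by
  simpa [perc_const] using perc_mono (P := P) (f := fun _ => 0) hp hp1 h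

lemma abs_perc_le (hp : 0 ≤ p) (hp1 : p ≤ 1) (f : Finset ε → ℝ) :
    |perc p P f| ≤ perc p P (fun E => |f E|) := by
  rw [abs_le]
  constructor
  · have := perc_mono (P := P) (f := fun E => (-1) * |f E|) (g := f) hp hp1
      (fun E _ => by linarith [neg_abs_le (f E)])
    rw [perc_const_mul] at this
    linarith
  · exact perc_mono hp hp1 fun E _ => le_abs_self _

lemma perc_union [DecidableEq ε] {Q : Finset ε} (h : Disjoint P Q) (f : Finset ε → ℝ) :
    perc p (P ∪ Q) f = perc p P (fun A => perc p Q (fun B => f (A ∪ B))) := by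
  unfold perc
  simp only [Finset.mul_sum]
  rw [← Finset.sum_product']
  symm
  refine Finset.sum_bij' (fun x _ => x.1 ∪ x.2) (fun E _ => (E ∩ P, E ∩ Q)) ?_ ?_ ?_ ?_ ?_
  · rintro ⟨A, B⟩ hx
    simp only [Finset.mem_product, Finset.mem_powerset] at hx ⊢
    exact Finset.union_subset_union hx.1 hx.2
  · intro E _
    simp [Finset.inter_subset_right]
  · rintro ⟨A, B⟩ hx
    simp only [Finset.mem_product, Finset.mem_powerset] at hx
    have h1 : B ∩ P = ∅ := Finset.disjoint_iff_inter_eq_empty.1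
      ((h.mono_right hx.2).symm)
    have h2 : A ∩ Q = ∅ := Finset.disjoint_iff_inter_eq_empty.1 (h.mono_left hx.1)
    ext : 1
    · simp [Finset.union_inter_distrib_right, h1, Finset.inter_eq_left.2 hx.1]
    · simp [Finset.union_inter_distrib_right, h2, Finset.inter_eq_left.2 hx.2]
  · intro E hE
    rw [Finset.mem_powerset] at hE
    simp [← Finset.inter_union_distrib_left, Finset.inter_eq_left.2 hE]
  · rintro ⟨A, B⟩ hx
    simp only [Finset.mem_product, Finset.mem_powerset] at hx
    have hAB : Disjoint A B := (h.mono_left hx.1).mono_right hx.2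
    simp only [Finset.card_union_of_disjoint h, Finset.card_union_of_disjoint hAB]
    have hA := Finset.card_le_card hx.1
    have hB := Finset.card_le_card hx.2
    have : P.card + Q.card - (A.card + B.card) = (P.card - A.card) + (Q.card - B.card) := by omega
    rw [this, pow_add, pow_add]
    ring

lemma perc_map {δ : Type*} (e : ε ↪ δ) (f : Finset δ → ℝ) :
    perc p (P.map e) f = perc p P (fun A => f (A.map e)) := by
  unfold perc
  symm
  refine Finset.sum_nbij (fun A => A.map e) ?_ ?_ ?_ ?_
  · intro A hA
    simpa using hA
  · intro A _ B _ h
    exact Finset.map_injective e h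
  · intro E hE
    simp only [Finset.coe_powerset, Set.mem_preimage, Set.mem_powerset_iff, Finset.coe_subset] at hE
    obtain ⟨u, hu, rfl⟩ := Finset.subset_map_iff.1 hE
    exact ⟨u, by simpa using hu, rfl⟩
  · intro A _
    simp

lemma perc_ite_eq_empty [DecidableEq ε] :
    perc p P (fun B => if B = ∅ then 1 else 0) = (1 - p) ^ P.card := by
  unfold perc
  simp

lemma perc_ite_superset [DecidableEq ε] {S : Finset ε} (hS : S ⊆ P) :
    perc p P (fun E => if S ⊆ E then 1 else 0) = p ^ S.card := by
  have h : P = S ∪ (P \ S) := (Finset.union_sdiff_of_subset hS).symm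
  rw [h, perc_union Finset.disjoint_sdiff]
  have : ∀ A ⊆ S, perc p (P \ S) (fun B => if S ⊆ A ∪ B then 1 else 0)
      = (if A = S then 1 else 0) := by
    intro A hA
    rw [perc_congr (g := fun _ => if A = S then 1 else 0), perc_const]
    intro B hB
    have : S ⊆ A ∪ B ↔ A = S := by
      constructor
      · intro hs
        refine Finset.Subset.antisymm hA fun x hx => ?_
        rcases Finset.mem_union.1 (hs hx) with h | h
        · exact h
        · exact absurd hx (Finset.mem_sdiff.1 (hB h)).2
      · rintro rfl
        exact Finset.subset_union_left
    simp [this]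
  rw [perc_congr this]
  unfold perc
  simp

/-- Events on disjoint sets of coordinates are independent. -/
lemma perc_mul_mul [DecidableEq ε] {P₁ P₂ Q : Finset ε} (h₁ : P₁ ⊆ P) (h₂ : P₂ ⊆ P) (hQ : Q ⊆ P)
    (h₁₂ : Disjoint P₁ P₂) (h₁Q : Disjoint P₁ Q) (h₂Q : Disjoint P₂ Q) (f g : Finset ε → ℝ) :
    perc p P (fun E => f (E ∩ P₁) * g (E ∩ P₂) * (if E ∩ Q = ∅ then 1 else 0)) =
      perc p P₁ f * perc p P₂ g * (1 - p) ^ Q.card := by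
  have hP : P = P₁ ∪ (P₂ ∪ (Q ∪ (P \ (P₁ ∪ P₂ ∪ Q)))) := by
    ext x
    have := @h₁ x
    have := @h₂ x
    have := @hQ x
    simp only [Finset.mem_union, Finset.mem_sdiff]
    tauto
  have d3 : Disjoint Q (P \ (P₁ ∪ P₂ ∪ Q)) := by
    rw [Finset.disjoint_left]; intro x; simp only [Finset.mem_union, Finset.mem_sdiff]; tauto
  have d2 : Disjoint P₂ (Q ∪ (P \ (P₁ ∪ P₂ ∪ Q))) := by
    rw [Finset.disjoint_left] at *
    intro x hx; have := h₂Q hx; simp only [Finset.mem_union, Finset.mem_sdiff]; tauto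
  have d1 : Disjoint P₁ (P₂ ∪ (Q ∪ (P \ (P₁ ∪ P₂ ∪ Q)))) := by
    rw [Finset.disjoint_left] at *
    intro x hx; have := h₁Q hx; have := h₁₂ hx
    simp only [Finset.mem_union, Finset.mem_sdiff]; tauto
  conv_lhs => rw [hP]
  rw [perc_union d1]
  have key : ∀ A ⊆ P₁, ∀ B ⊆ P₂, ∀ C ⊆ Q, ∀ D ⊆ P \ (P₁ ∪ P₂ ∪ Q),
      (A ∪ (B ∪ (C ∪ D))) ∩ P₁ = A ∧ (A ∪ (B ∪ (C ∪ D))) ∩ P₂ = B ∧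
        (A ∪ (B ∪ (C ∪ D))) ∩ Q = C := by
    intro A hA B hB C hC D hD
    clear hP d1 d2 d3
    rw [Finset.disjoint_left] at h₁₂ h₁Q h₂Q
    refine ⟨?_, ?_, ?_⟩ <;>
    · ext x
      have a := @hA x
      have b := @hB x
      have c := @hC x
      have d := @hD x
      have e := @h₁₂ x
      have f := @h₁Q x
      have g := @h₂Q x
      simp only [Finset.mem_union, Finset.mem_sdiff, Finset.mem_inter] at d ⊢
      by_cases x ∈ P₁ <;> by_cases x ∈ P₂ <;> by_cases x ∈ Q <;> simp_all
  rw [mul_assoc, ← perc_mul_const]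
  refine perc_congr fun A hA => ?_
  rw [perc_union d2, ← perc_mul_const, ← perc_const_mul]
  refine perc_congr fun B hB => ?_
  rw [perc_union d3, ← perc_ite_eq_empty, ← perc_const_mul, ← perc_const_mul]
  refine perc_congr fun C hC => ?_
  refine (perc_congr (g := fun _ => f A * (g B * (if C = ∅ then 1 else 0)))
    fun D hD => ?_).trans (perc_const _)
  obtain ⟨k1, k2, k3⟩ := key A hA B hB C hC D hD
  rw [k1, k2, k3]
  ring

/-- The variance of a function of a random subset. -/
noncomputable def percVar (p : ℝ) (P : Finset ε) (f : Finset ε → ℝ) : ℝ :=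
  perc p P (fun E => f E ^ 2) - perc p P f ^ 2

lemma percVar_eq (f : Finset ε → ℝ) :
    percVar p P f = perc p P (fun E => (f E - perc p P f) ^ 2) := by
  set m := perc p P f with hm
  have : ∀ E ⊆ P, (f E - m) ^ 2 = f E ^ 2 - (2 * m) * f E + m ^ 2 := fun E _ => by ring
  rw [perc_congr this, perc_add, perc_sub, perc_const_mul, perc_const, percVar, ← hm]
  ring

lemma percVar_add_le (hp : 0 ≤ p) (hp1 : p ≤ 1) (f g : Finset ε → ℝ) :
    percVar p P (fun E => f E + g E) ≤ 2 * percVar p P f + 2 * perc p P (fun E => g E ^ 2) := by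
  have hg : percVar p P g ≤ perc p P (fun E => g E ^ 2) := by
    unfold percVar; nlinarith [sq_nonneg (perc p P g)]
  have : percVar p P (fun E => f E + g E) ≤ 2 * percVar p P f + 2 * percVar p P g := by
    rw [percVar_eq, percVar_eq f, percVar_eq g, perc_add f g, ← perc_const_mul,
      ← perc_const_mul]
    refine le_trans ?_ (perc_add _ _).le
    refine perc_mono hp hp1 fun E _ => ?_
    nlinarith [sq_nonneg ((f E - perc p P f) - (g E - perc p P g))]
  linarith

end perc

lemma erExp_eq_perc (n : ℕ) (p : ℝ) (f : Finset (Fin n × Fin n) → ℝ) :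
    erExp n p f = perc p (allPairs n) f := rfl

/-! ### Components of the random graph -/

section components
variable {n : ℕ}

lemma graphOf_adj {E : Finset (Fin n × Fin n)} {u v : Fin n} :
    (graphOf E).Adj u v ↔ u ≠ v ∧ ((u, v) ∈ E ∨ (v, u) ∈ E) := by
  simp [graphOf, SimpleGraph.fromRel_adj]

lemma graphOf_mono {E E' : Finset (Fin n × Fin n)} (h : E ⊆ E') : graphOf E ≤ graphOf E' := by
  intro u v huv
  rw [graphOf_adj] at huv ⊢
  exact ⟨huv.1, huv.2.imp (fun a => h a) (fun a => h a)⟩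

lemma mem_allPairs {e : Fin n × Fin n} : e ∈ allPairs n ↔ e.1 < e.2 := by
  simp [allPairs]

/-- The pairs with one end in `U` and the other one in `W`. -/
noncomputable def pairsBetween (U W : Finset (Fin n)) : Finset (Fin n × Fin n) :=
  (allPairs n).filter fun e => e.1 ∈ U ∧ e.2 ∈ W ∨ e.1 ∈ W ∧ e.2 ∈ U

/-- The pairs with both ends in `W`. -/
noncomputable def pairsIn (W : Finset (Fin n)) : Finset (Fin n × Fin n) :=
  (allPairs n).filter fun e => e.1 ∈ W ∧ e.2 ∈ W

/-- The pairs with exactly one end in `W`. -/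
noncomputable def cutPairs (W : Finset (Fin n)) : Finset (Fin n × Fin n) :=
  pairsBetween W Wᶜ

/-- The edges `E` connect the non-empty set `W`. -/
def ConnectsSet (W : Finset (Fin n)) (E : Finset (Fin n × Fin n)) : Prop :=
  W.Nonempty ∧ ∀ u ∈ W, ∀ v ∈ W, (graphOf E).Reachable u v

/-- `W` is the vertex set of a connected component of the graph with edges `E`. -/
def IsCompSet (W : Finset (Fin n)) (E : Finset (Fin n × Fin n)) : Prop :=
  E ∩ cutPairs W = ∅ ∧ ConnectsSet W (E ∩ pairsIn W)

/-- The vertex set of the connected component of `v`. -/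
noncomputable def compSet (E : Finset (Fin n × Fin n)) (v : Fin n) : Finset (Fin n) :=
  Finset.univ.filter fun u => (graphOf E).Reachable v u

lemma card_compSet (E : Finset (Fin n × Fin n)) (v : Fin n) :
    (compSet E v).card = compCard E v := rfl

lemma mem_compSet {E : Finset (Fin n × Fin n)} {u v : Fin n} :
    u ∈ compSet E v ↔ (graphOf E).Reachable v u := by
  simp [compSet]

lemma card_pairsBetween {U W : Finset (Fin n)} (h : Disjoint U W) :
    (pairsBetween U W).card = U.card * W.card := by
  rw [← Finset.card_product]
  rw [Finset.disjoint_left] at h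
  refine Finset.card_bij' (fun e _ => if e.1 ∈ U then e else (e.2, e.1))
    (fun e _ => if e.1 < e.2 then e else (e.2, e.1)) ?_ ?_ ?_ ?_
  · rintro ⟨a, b⟩ he
    simp only [pairsBetween, Finset.mem_filter, mem_allPairs] at he
    have := @h a
    by_cases ha : a ∈ U <;> simp_all
  · rintro ⟨a, b⟩ he
    simp only [Finset.mem_product] at he
    have hne : a ≠ b := fun hab => h he.1 (hab ▸ he.2)
    by_cases hab : a < b
    · simp [pairsBetween, mem_allPairs, hab, he]
    · have : b < a := lt_of_le_of_ne (not_lt.1 hab) hne.symm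
      simp [pairsBetween, mem_allPairs, hab, he, this]
  · rintro ⟨a, b⟩ he
    simp only [pairsBetween, Finset.mem_filter, mem_allPairs] at he
    by_cases ha : a ∈ U
    · simp [ha, he.1]
    · simp [ha, he.1.not_gt]
  · rintro ⟨a, b⟩ he
    simp only [Finset.mem_product] at he
    by_cases hab : a < b
    · simp [hab, he]
    · have := h (a := b)
      have hb : b ∉ U := fun hb => this hb he.2
      simp [hab, hb]

lemma card_cutPairs (W : Finset (Fin n)) : (cutPairs W).card = W.card * (n - W.card) := by
  rw [cutPairs, card_pairsBetween disjoint_compl_right, Finset.card_compl, Fintype.card_fin]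

lemma card_cutPairs_union {W W' : Finset (Fin n)} (h : Disjoint W W') :
    (cutPairs W ∪ cutPairs W').card =
      W.card * (n - W.card) + W'.card * (n - W.card - W'.card) := by
  have h1 : cutPairs W ∪ cutPairs W' = cutPairs W ∪ pairsBetween W' (W ∪ W')ᶜ := by
    ext ⟨a, b⟩
    have ha : a ∈ W → a ∉ W' := fun hW => Finset.disjoint_left.1 h hW
    have hb : b ∈ W → b ∉ W' := fun hW => Finset.disjoint_left.1 h hW
    simp only [cutPairs, pairsBetween, Finset.mem_union, Finset.mem_filter, Finset.mem_compl]
    tauto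
  have h2 : Disjoint (cutPairs W) (pairsBetween W' (W ∪ W')ᶜ) := by
    rw [Finset.disjoint_left]
    rintro ⟨a, b⟩
    have ha : a ∈ W → a ∉ W' := fun hW => Finset.disjoint_left.1 h hW
    have hb : b ∈ W → b ∉ W' := fun hW => Finset.disjoint_left.1 h hW
    simp only [cutPairs, pairsBetween, Finset.mem_union, Finset.mem_filter, Finset.mem_compl]
    tauto
  have h3 : Disjoint W' (W ∪ W')ᶜ := by
    rw [Finset.disjoint_left]; intro x hx; simp [hx]
  rw [h1, Finset.card_union_of_disjoint h2, card_cutPairs, card_pairsBetween h3,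
    Finset.card_compl, Finset.card_union_of_disjoint h, Fintype.card_fin, Nat.sub_sub]

lemma mem_and_reachable_of_inter_cutPairs {E : Finset (Fin n × Fin n)} (hE : E ⊆ allPairs n)
    {W : Finset (Fin n)} (hW : E ∩ cutPairs W = ∅) {u x : Fin n} (hu : u ∈ W)
    (h : (graphOf E).Reachable u x) :
    x ∈ W ∧ (graphOf (E ∩ pairsIn W)).Reachable u x := by
  rw [SimpleGraph.reachable_iff_reflTransGen] at h
  induction h with
  | refl => exact ⟨hu, SimpleGraph.Reachable.refl _⟩
  | @tail b c hb hbc ih =>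
    obtain ⟨hbW, ih⟩ := ih
    rw [graphOf_adj] at hbc
    have hcW : c ∈ W := by
      by_contra hc
      rcases hbc.2 with he | he
      · have : (b, c) ∈ E ∩ cutPairs W := by
          simp [cutPairs, pairsBetween, he, hE he, hbW, hc]
        simp [hW] at this
      · have : (c, b) ∈ E ∩ cutPairs W := by
          simp [cutPairs, pairsBetween, he, hE he, hbW, hc]
        simp [hW] at this
    refine ⟨hcW, ih.trans (SimpleGraph.Adj.reachable ?_)⟩
    rw [graphOf_adj]
    refine ⟨hbc.1, hbc.2.imp (fun he => ?_) fun he => ?_⟩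
    · simp [pairsIn, he, hE he, hbW, hcW]
    · simp [pairsIn, he, hE he, hbW, hcW]

lemma compSet_eq_iff {E : Finset (Fin n × Fin n)} (hE : E ⊆ allPairs n) {W : Finset (Fin n)}
    {v : Fin n} : compSet E v = W ↔ v ∈ W ∧ IsCompSet W E := by
  constructor
  · rintro rfl
    have hv : v ∈ compSet E v := mem_compSet.2 (SimpleGraph.Reachable.refl _)
    have hcut : E ∩ cutPairs (compSet E v) = ∅ := by
      rw [Finset.eq_empty_iff_forall_notMem]
      rintro ⟨a, b⟩ he
      simp only [Finset.mem_inter, cutPairs, pairsBetween, Finset.mem_filter, mem_allPairs,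
        Finset.mem_compl, mem_compSet] at he
      obtain ⟨heE, hlt, h⟩ := he
      have hab : (graphOf E).Adj a b := graphOf_adj.2 ⟨hlt.ne, Or.inl heE⟩
      rcases h with h | h
      · exact h.2 (h.1.trans hab.reachable)
      · exact h.1 (h.2.trans hab.symm.reachable)
    refine ⟨hv, hcut, ⟨v, hv⟩, fun a ha b hb => ?_⟩
    exact ((mem_and_reachable_of_inter_cutPairs hE hcut hv (mem_compSet.1 ha)).2.symm).trans
      (mem_and_reachable_of_inter_cutPairs hE hcut hv (mem_compSet.1 hb)).2
  · rintro ⟨hv, hcut, -, hconn⟩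
    ext x
    rw [mem_compSet]
    constructor
    · exact fun h => (mem_and_reachable_of_inter_cutPairs hE hcut hv h).1
    · exact fun hx => (hconn v hv x hx).mono (graphOf_mono Finset.inter_subset_left)

lemma IsCompSet.nonempty {W : Finset (Fin n)} {E : Finset (Fin n × Fin n)} (h : IsCompSet W E) :
    W.Nonempty := h.2.1

lemma IsCompSet.compSet_eq {E : Finset (Fin n × Fin n)} (hE : E ⊆ allPairs n)
    {W : Finset (Fin n)} (h : IsCompSet W E) {v : Fin n} (hv : v ∈ W) : compSet E v = W :=
  (compSet_eq_iff hE).2 ⟨hv, h⟩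

lemma isCompSet_compSet {E : Finset (Fin n × Fin n)} (hE : E ⊆ allPairs n) (v : Fin n) :
    IsCompSet (compSet E v) E := ((compSet_eq_iff hE).1 rfl).2

lemma IsCompSet.disjoint {E : Finset (Fin n × Fin n)} (hE : E ⊆ allPairs n)
    {W W' : Finset (Fin n)} (h : IsCompSet W E) (h' : IsCompSet W' E) (hne : W ≠ W') :
    Disjoint W W' := by
  rw [Finset.disjoint_left]
  intro v hv hw
  exact hne ((h.compSet_eq hE hv).symm.trans (h'.compSet_eq hE hw))

/-- The indicator of the event that `W` is a component. -/
noncomputable def compInd (W : Finset (Fin n)) (E : Finset (Fin n × Fin n)) : ℝ :=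
  if IsCompSet W E then 1 else 0

lemma compInd_nonneg (W : Finset (Fin n)) (E : Finset (Fin n × Fin n)) : 0 ≤ compInd W E := by
  unfold compInd; split_ifs <;> norm_num

lemma compInd_sq (W : Finset (Fin n)) (E : Finset (Fin n × Fin n)) :
    compInd W E * compInd W E = compInd W E := by
  unfold compInd; split_ifs <;> norm_num

lemma sum_compCard {E : Finset (Fin n × Fin n)} (hE : E ⊆ allPairs n) (g : ℕ → ℝ) :
    ∑ v : Fin n, g (compCard E v) =
      ∑ W : Finset (Fin n), (W.card * g W.card) * compInd W E := by
  have h1 : ∀ v : Fin n, g (compCard E v) =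
      ∑ W : Finset (Fin n), if v ∈ W then g W.card * compInd W E else 0 := by
    intro v
    rw [Finset.sum_eq_single (compSet E v)]
    · obtain ⟨hv, hc⟩ := (compSet_eq_iff hE (v := v)).1 rfl
      simp [hv, compInd, hc, card_compSet]
    · intro W _ hW
      by_cases hv : v ∈ W
      · have : ¬ IsCompSet W E := fun h => hW (h.compSet_eq hE hv).symm
        simp [compInd, this]
      · simp [hv]
    · simp
  simp only [h1]
  rw [Finset.sum_comm]
  refine Finset.sum_congr rfl fun W _ => ?_
  simp [mul_assoc]

/-! ### Probabilities of components -/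

/-- The probability that the random graph on `k` vertices is connected. -/
noncomputable def connProb (p : ℝ) (k : ℕ) : ℝ :=
  perc p (allPairs k) fun E => if ConnectsSet univ E then 1 else 0

lemma connProb_zero (p : ℝ) : connProb p 0 = 0 := by
  have : ∀ E : Finset (Fin 0 × Fin 0), ¬ ConnectsSet univ E := fun E h => by
    obtain ⟨x, _⟩ := h.1
    exact x.elim0
  simp only [connProb, this, if_false, perc_const]

lemma connProb_nonneg {p : ℝ} (hp : 0 ≤ p) (hp1 : p ≤ 1) (k : ℕ) : 0 ≤ connProb p k :=
  perc_nonneg hp hp1 fun E _ => by split_ifs <;> norm_num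

lemma reachable_graphOf_map {k : ℕ} (f : Fin k ↪o Fin n) (A : Finset (Fin k × Fin k))
    (a b : Fin k) :
    (graphOf (A.map (f.toEmbedding.prodMap f.toEmbedding))).Reachable (f a) (f b) ↔
      (graphOf A).Reachable a b := by
  have hadj : ∀ x y, (graphOf (A.map (f.toEmbedding.prodMap f.toEmbedding))).Adj x y ↔
      ∃ a b, f a = x ∧ f b = y ∧ (graphOf A).Adj a b := by
    intro x y
    simp only [graphOf_adj, Finset.mem_map, Prod.exists, Function.Embedding.coe_prodMap,
      Prod.map_apply, Prod.mk.injEq, RelEmbedding.coe_toEmbedding]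
    constructor
    · rintro ⟨hne, ⟨a, b, hA, rfl, rfl⟩ | ⟨a, b, hA, rfl, rfl⟩⟩
      · exact ⟨a, b, rfl, rfl, fun h => hne (h ▸ rfl), Or.inl hA⟩
      · exact ⟨b, a, rfl, rfl, fun h => hne (h ▸ rfl), Or.inr hA⟩
    · rintro ⟨a, b, rfl, rfl, hne, h⟩
      exact ⟨fun h => hne (f.injective h), h.imp (fun h => ⟨a, b, h, rfl, rfl⟩)
        (fun h => ⟨b, a, h, rfl, rfl⟩)⟩
  constructor
  · intro h
    have : ∀ x, Relation.ReflTransGen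
        (graphOf (A.map (f.toEmbedding.prodMap f.toEmbedding))).Adj (f a) x →
        ∃ c, f c = x ∧ (graphOf A).Reachable a c := by
      intro x hx
      induction hx with
      | refl => exact ⟨a, rfl, SimpleGraph.Reachable.refl _⟩
      | tail _ hbc ih =>
        obtain ⟨c, rfl, hc⟩ := ih
        obtain ⟨c', d, h1, rfl, hd⟩ := (hadj _ _).1 hbc
        rw [f.injective h1] at hd
        exact ⟨d, rfl, hc.trans hd.reachable⟩
    obtain ⟨c, hc, hac⟩ := this _ ((SimpleGraph.reachable_iff_reflTransGen _ _).1 h)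
    rwa [f.injective hc] at hac
  · intro h
    rw [SimpleGraph.reachable_iff_reflTransGen] at h
    induction h with
    | refl => exact SimpleGraph.Reachable.refl _
    | tail _ hbc ih =>
      exact ih.trans (SimpleGraph.Adj.reachable ((hadj _ _).2 ⟨_, _, rfl, rfl, hbc⟩))

lemma perc_connectsSet (p : ℝ) (W : Finset (Fin n)) :
    perc p (pairsIn W) (fun E => if ConnectsSet W E then 1 else 0) = connProb p W.card := by
  set f := W.orderEmbOfFin rfl with hf
  have hmem : ∀ x, x ∈ W ↔ ∃ a, f a = x := by
    intro x
    rw [← Set.mem_range, hf, Finset.range_orderEmbOfFin, Finset.mem_coe]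
  have hpairs : pairsIn W = (allPairs W.card).map (f.toEmbedding.prodMap f.toEmbedding) := by
    ext ⟨x, y⟩
    simp only [pairsIn, Finset.mem_filter, mem_allPairs, hmem, Finset.mem_map, Prod.exists,
      Function.Embedding.coe_prodMap, Prod.map_apply, Prod.mk.injEq, RelEmbedding.coe_toEmbedding]
    constructor
    · rintro ⟨hlt, ⟨a, rfl⟩, ⟨b, rfl⟩⟩
      exact ⟨a, b, f.lt_iff_lt.1 hlt, rfl, rfl⟩
    · rintro ⟨a, b, hlt, rfl, rfl⟩
      exact ⟨f.lt_iff_lt.2 hlt, ⟨a, rfl⟩, ⟨b, rfl⟩⟩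
  rw [hpairs, perc_map, connProb]
  refine perc_congr fun A _ => ?_
  have : ConnectsSet W (A.map (f.toEmbedding.prodMap f.toEmbedding)) ↔ ConnectsSet univ A := by
    unfold ConnectsSet
    have hne : W.Nonempty ↔ (univ : Finset (Fin W.card)).Nonempty := by
      rw [← Finset.card_pos, ← Finset.card_pos, Finset.card_univ, Fintype.card_fin]
    rw [hne]
    refine and_congr Iff.rfl ?_
    constructor
    · intro h a _ b _
      exact (reachable_graphOf_map f A a b).1 (h _ ((hmem _).2 ⟨a, rfl⟩) _ ((hmem _).2 ⟨b, rfl⟩))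
    · intro h x hx y hy
      obtain ⟨a, rfl⟩ := (hmem x).1 hx
      obtain ⟨b, rfl⟩ := (hmem y).1 hy
      exact (reachable_graphOf_map f A a b).2 (h a (Finset.mem_univ _) b (Finset.mem_univ _))
  simp only [this]

lemma disjoint_pairsIn {W W' : Finset (Fin n)} (h : Disjoint W W') :
    Disjoint (pairsIn W) (pairsIn W') := by
  rw [Finset.disjoint_left] at h ⊢
  rintro ⟨a, b⟩
  have := @h a
  simp only [pairsIn, Finset.mem_filter]
  tauto

lemma disjoint_pairsIn_cutPairs (W : Finset (Fin n)) : Disjoint (pairsIn W) (cutPairs W) := by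
  rw [Finset.disjoint_left]
  rintro ⟨a, b⟩
  simp only [pairsIn, cutPairs, pairsBetween, Finset.mem_filter, Finset.mem_compl]
  tauto

lemma disjoint_pairsIn_cutPairs_of_disjoint {W W' : Finset (Fin n)} (h : Disjoint W W') :
    Disjoint (pairsIn W) (cutPairs W') := by
  rw [Finset.disjoint_left] at h ⊢
  rintro ⟨a, b⟩
  have := @h a
  have := @h b
  simp only [pairsIn, cutPairs, pairsBetween, Finset.mem_filter, Finset.mem_compl]
  tauto

lemma pairsIn_subset (W : Finset (Fin n)) : pairsIn W ⊆ allPairs n := Finset.filter_subset _ _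

lemma cutPairs_subset (W : Finset (Fin n)) : cutPairs W ⊆ allPairs n := Finset.filter_subset _ _

lemma perc_compInd_mul (p : ℝ) {W W' : Finset (Fin n)} (h : Disjoint W W') :
    perc p (allPairs n) (fun E => compInd W E * compInd W' E) =
      connProb p W.card * connProb p W'.card *
        (1 - p) ^ (W.card * (n - W.card) + W'.card * (n - W.card - W'.card)) := by
  rw [← card_cutPairs_union h, ← perc_connectsSet, ← perc_connectsSet]
  rw [← perc_mul_mul (P := allPairs n) (pairsIn_subset W) (pairsIn_subset W')
    (Finset.union_subset (cutPairs_subset W) (cutPairs_subset W'))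
    (disjoint_pairsIn h)
    (Finset.disjoint_union_right.2 ⟨disjoint_pairsIn_cutPairs W,
      disjoint_pairsIn_cutPairs_of_disjoint h⟩)
    (Finset.disjoint_union_right.2 ⟨disjoint_pairsIn_cutPairs_of_disjoint h.symm,
      disjoint_pairsIn_cutPairs W'⟩)]
  refine perc_congr fun E _ => ?_
  have : E ∩ (cutPairs W ∪ cutPairs W') = ∅ ↔ E ∩ cutPairs W = ∅ ∧ E ∩ cutPairs W' = ∅ := by
    rw [Finset.inter_union_distrib_left, Finset.union_eq_empty]
  simp only [this, compInd, IsCompSet]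
  by_cases h1 : E ∩ cutPairs W = ∅ <;> by_cases h2 : E ∩ cutPairs W' = ∅ <;> simp [h1, h2]

lemma perc_compInd (p : ℝ) (W : Finset (Fin n)) :
    perc p (allPairs n) (fun E => compInd W E) =
      connProb p W.card * (1 - p) ^ (W.card * (n - W.card)) := by
  rw [← card_cutPairs, ← perc_connectsSet]
  have := perc_mul_mul (p := p) (P := allPairs n) (P₁ := pairsIn W) (P₂ := ∅) (Q := cutPairs W)
    (pairsIn_subset W) (Finset.empty_subset _) (cutPairs_subset W)
    (Finset.disjoint_empty_right _) (disjoint_pairsIn_cutPairs W) (Finset.disjoint_empty_left _)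
    (fun E => if ConnectsSet W E then 1 else 0) (fun _ => 1)
  rw [perc_const, mul_one] at this
  rw [← this]
  refine perc_congr fun E _ => ?_
  simp only [compInd, IsCompSet]
  by_cases h1 : E ∩ cutPairs W = ∅ <;> simp [h1]

lemma perc_compInd_mul_eq_zero (p : ℝ) {W W' : Finset (Fin n)} (hne : W ≠ W')
    (h : ¬ Disjoint W W') : perc p (allPairs n) (fun E => compInd W E * compInd W' E) = 0 := by
  rw [← perc_const (p := p) (P := allPairs n) 0]
  refine perc_congr fun E hE => ?_
  by_contra h0
  refine h (IsCompSet.disjoint hE (E := E) ?_ ?_ hne)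
  · by_contra hc; exact h0 (by simp [compInd, hc])
  · by_contra hc; exact h0 (by simp [compInd, hc])

/-- The expected number of components of size `k` in the random graph on `n` vertices. -/
noncomputable def expComps (p : ℝ) (n k : ℕ) : ℝ :=
  n.choose k * (connProb p k * (1 - p) ^ (k * (n - k)))

lemma expComps_nonneg {p : ℝ} (hp : 0 ≤ p) (hp1 : p ≤ 1) (n k : ℕ) : 0 ≤ expComps p n k := by
  have := connProb_nonneg hp hp1 k
  have : 0 ≤ 1 - p := by linarith
  unfold expComps
  positivity

lemma expComps_zero (p : ℝ) (n : ℕ) : expComps p n 0 = 0 := by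
  simp [expComps, connProb_zero]

lemma sum_univ_card (n : ℕ) (f : ℕ → ℝ) :
    ∑ W : Finset (Fin n), f W.card = ∑ k ∈ range (n + 1), n.choose k * f k := by
  rw [← Finset.powerset_univ, Finset.sum_powerset_apply_card, Finset.card_univ, Fintype.card_fin]
  simp

lemma perc_sum_compInd (p : ℝ) (n : ℕ) (h : ℕ → ℝ) :
    perc p (allPairs n) (fun E => ∑ W : Finset (Fin n), h W.card * compInd W E) =
      ∑ k ∈ range (n + 1), h k * expComps p n k := by
  rw [perc_sum]
  simp only [perc_const_mul, perc_compInd]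
  rw [sum_univ_card n (fun k => h k * (connProb p k * (1 - p) ^ (k * (n - k))))]
  exact Finset.sum_congr rfl fun k _ => by rw [expComps]; ring

lemma sum_mul_expComps (p : ℝ) (n : ℕ) : ∑ k ∈ range (n + 1), (k : ℝ) * expComps p n k = n := by
  rw [← perc_sum_compInd p n (fun k => (k : ℝ)), perc_congr (g := fun _ => (n : ℝ)), perc_const]
  intro E hE
  have := sum_compCard hE (fun _ => 1)
  simp only [mul_one] at this
  rw [← this]
  simp

lemma mul_expComps_le {p : ℝ} (hp : 0 ≤ p) (hp1 : p ≤ 1) (n k : ℕ) :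
    (k : ℝ) * expComps p n k ≤ n := by
  by_cases hk : k ≤ n
  · rw [← sum_mul_expComps p n]
    exact Finset.single_le_sum (f := fun k : ℕ => (k : ℝ) * expComps p n k)
      (fun i _ => mul_nonneg (Nat.cast_nonneg _) (expComps_nonneg hp hp1 n i))
      (Finset.mem_range.2 (by omega))
  · simp [expComps, Nat.choose_eq_zero_of_lt (not_le.1 hk)]

end components

/-! ### Connectivity probability and spanning trees -/

/-- The number of labelled trees on `k` vertices. -/
noncomputable def treeCount (k : ℕ) : ℕ :=
  ((allPairs k).powerset.filter fun E => ConnectsSet univ E ∧ E.card + 1 = k).card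

lemma treeCount_one_pos : 0 < treeCount 1 := by
  refine Finset.card_pos.2 ⟨∅, ?_⟩
  simp only [Finset.mem_filter, Finset.mem_powerset, Finset.empty_subset, true_and,
    Finset.card_empty, zero_add, and_true]
  refine ⟨Finset.univ_nonempty, fun u _ v _ => ?_⟩
  rw [Subsingleton.elim u v]

lemma exists_tree_subset {k : ℕ} {E : Finset (Fin k × Fin k)} (hE : E ⊆ allPairs k)
    (hc : ConnectsSet univ E) : ∃ T ⊆ E, ConnectsSet univ T ∧ T.card + 1 = k := by
  have hconn : (graphOf E).Connected :=
    { preconnected := fun u v => hc.2 u (Finset.mem_univ _) v (Finset.mem_univ _)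
      nonempty := ⟨hc.1.choose⟩ }
  obtain ⟨G, hle, hG⟩ := hconn.exists_isTree_le
  set T := (allPairs k).filter fun e => G.Adj e.1 e.2 with hT
  have hTG : graphOf T = G := by
    ext u v
    rw [graphOf_adj]
    simp only [hT, Finset.mem_filter, mem_allPairs]
    constructor
    · rintro ⟨-, h | h⟩
      · exact h.2
      · exact h.2.symm
    · intro h
      exact ⟨h.ne, (lt_or_gt_of_ne h.ne).imp (fun a => ⟨a, h⟩) (fun a => ⟨a, h.symm⟩)⟩
  refine ⟨T, ?_, ⟨hc.1, fun u _ v _ => ?_⟩, ?_⟩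
  · rintro ⟨a, b⟩ he
    simp only [hT, Finset.mem_filter, mem_allPairs] at he
    have := hle he.2
    rw [graphOf_adj] at this
    rcases this.2 with h | h
    · exact h
    · have := mem_allPairs.1 (hE h)
      exact absurd he.1 this.not_gt
  · rw [hTG]
    exact hG.connected.preconnected u v
  · have h1 := hG.card_edgeFinset
    rw [Fintype.card_fin] at h1
    refine Eq.trans (congrArg (· + 1) ?_) h1
    refine Finset.card_bij (fun e _ => s(e.1, e.2)) ?_ ?_ ?_
    · rintro ⟨a, b⟩ he
      simp only [hT, Finset.mem_filter] at he
      simpa using he.2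
    · rintro ⟨a, b⟩ he ⟨a', b'⟩ he' h
      simp only [hT, Finset.mem_filter, mem_allPairs] at he he'
      simp only [Sym2.eq_iff] at h
      rcases h with h | h
      · exact Prod.ext h.1 h.2
      · have h1 := he.1
        rw [h.1, h.2] at h1
        exact absurd he'.1 h1.not_gt
    · intro e
      induction e using Sym2.ind with
      | _ a b =>
        intro he
        simp only [SimpleGraph.mem_edgeFinset, SimpleGraph.mem_edgeSet] at he
        rcases lt_or_gt_of_ne he.ne with h | h
        · exact ⟨(a, b), by simp [hT, mem_allPairs, h, he], rfl⟩
        · exact ⟨(b, a), by simp [hT, mem_allPairs, h, he.symm], Sym2.eq_swap⟩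

lemma connProb_le {p : ℝ} (hp : 0 ≤ p) (hp1 : p ≤ 1) (k : ℕ) :
    connProb p k ≤ treeCount k * p ^ (k - 1) := by
  set 𝒯 := (allPairs k).powerset.filter fun E => ConnectsSet univ E ∧ E.card + 1 = k with h𝒯
  calc connProb p k ≤ perc p (allPairs k) (fun E => ∑ T ∈ 𝒯, if T ⊆ E then 1 else 0) := by
        refine perc_mono hp hp1 fun E hE => ?_
        split_ifs with h
        · obtain ⟨T, hTE, hT⟩ := exists_tree_subset hE h
          have hT𝒯 : T ∈ 𝒯 := by
            simp only [h𝒯, Finset.mem_filter, Finset.mem_powerset]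
            exact ⟨hTE.trans hE, hT⟩
          refine le_trans ?_ (Finset.single_le_sum (f := fun T => if T ⊆ E then (1 : ℝ) else 0)
            (fun i _ => by split_ifs <;> norm_num) hT𝒯)
          simp [hTE]
        · exact Finset.sum_nonneg fun i _ => by split_ifs <;> norm_num
    _ = ∑ T ∈ 𝒯, p ^ (k - 1) := by
        rw [perc_sum]
        refine Finset.sum_congr rfl fun T hT => ?_
        simp only [h𝒯, Finset.mem_filter, Finset.mem_powerset] at hT
        rw [perc_ite_superset hT.1]
        congr 1
        omega
    _ = treeCount k * p ^ (k - 1) := by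
        rw [Finset.sum_const, nsmul_eq_mul, h𝒯, treeCount]

lemma le_connProb {p : ℝ} (hp : 0 ≤ p) (hp1 : p ≤ 1) (k : ℕ) :
    treeCount k * p ^ (k - 1) * (1 - p) ^ (k * k) ≤ connProb p k := by
  have hq : 0 ≤ 1 - p := by linarith
  set 𝒯 := (allPairs k).powerset.filter fun E => ConnectsSet univ E ∧ E.card + 1 = k with h𝒯
  have hcard : (allPairs k).card ≤ k * k := by
    refine (Finset.card_filter_le _ _).trans ?_
    simp
  calc treeCount k * p ^ (k - 1) * (1 - p) ^ (k * k)
      = ∑ T ∈ 𝒯, p ^ (k - 1) * (1 - p) ^ (k * k) := by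
        rw [Finset.sum_const, nsmul_eq_mul, h𝒯, treeCount, mul_assoc]
    _ ≤ ∑ T ∈ 𝒯, p ^ T.card * (1 - p) ^ ((allPairs k).card - T.card) *
          (if ConnectsSet univ T then 1 else 0) := by
        refine Finset.sum_le_sum fun T hT => ?_
        simp only [h𝒯, Finset.mem_filter, Finset.mem_powerset] at hT
        rw [if_pos hT.2.1, mul_one]
        have : T.card = k - 1 := by omega
        rw [this]
        exact mul_le_mul_of_nonneg_left
          (pow_le_pow_of_le_one hq (by linarith) (by omega)) (by positivity)
    _ ≤ connProb p k := by
        refine Finset.sum_le_sum_of_subset_of_nonneg (Finset.filter_subset _ _) fun T _ _ => ?_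
        split_ifs <;> positivity

/-! ### Comparison of different numbers of vertices -/

lemma expComps_succ_mul (p : ℝ) {m k : ℕ} (hk : k ≤ m) :
    expComps p (m + 1) k * ((m : ℝ) + 1 - k) = expComps p m k * ((m + 1) * (1 - p) ^ k) := by
  have h1 := Nat.choose_mul_succ_eq m k
  have h2 : ((m.choose k : ℝ)) * (m + 1) = (m + 1).choose k * ((m : ℝ) + 1 - k) := by
    have := congrArg (Nat.cast : ℕ → ℝ) h1
    rw [Nat.cast_mul, Nat.cast_mul, Nat.cast_sub (by omega)] at this
    push_cast at this
    exact this
  have h3 : k * (m + 1 - k) = k * (m - k) + k := by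
    rw [Nat.succ_sub hk, Nat.mul_succ]
  simp only [expComps, h3, pow_add]
  linear_combination (-(connProb p k * (1 - p) ^ (k * (m - k)) * (1 - p) ^ k)) * h2

lemma expComps_eq_zero (p : ℝ) {m k : ℕ} (h : m < k) : expComps p m k = 0 := by
  simp [expComps, Nat.choose_eq_zero_of_lt h]

lemma exp_neg_le_one_sub {p : ℝ} (hp1 : p ≤ 1 / 2) :
    Real.exp (-(p * (1 + 2 * p))) ≤ 1 - p := by
  have h1 : 0 < 1 - p := by linarith
  rw [← Real.le_log_iff_exp_le h1]
  have := Real.one_sub_inv_le_log_of_pos h1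
  refine le_trans ?_ this
  have h2 : (1 - p)⁻¹ ≤ 1 + p * (1 + 2 * p) := by
    rw [inv_le_iff_one_le_mul₀ h1]
    nlinarith [mul_nonneg (sq_nonneg p) (by linarith : 0 ≤ 1 - 2 * p)]
  linarith

lemma expComps_le_of_subcritical {ε p : ℝ} (hε : 0 < ε) (hε1 : ε < 1) (hp : 0 < p)
    (hpε : p ≤ ε / 8) {n : ℕ} (hn : n * p ≤ 1 - ε) (k : ℕ) :
    k * expComps p n k ≤ p⁻¹ * Real.exp (-(ε ^ 2 / 16) * k) := by
  have hp1 : p ≤ 1 := by linarith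
  set N := ⌊(1 - ε / 2) / p⌋₊ with hN
  have hNle : (N : ℝ) ≤ (1 - ε / 2) / p := Nat.floor_le (by apply div_nonneg <;> linarith)
  have hNp : N * p ≤ 1 - ε / 2 := by rwa [le_div_iff₀ hp] at hNle
  have hNlt : 1 - ε / 2 < (N + 1) * p := by
    have := Nat.lt_floor_add_one ((1 - ε / 2) / p)
    rwa [div_lt_iff₀ hp] at this
  have step : ∀ m < N, expComps p m k ≤ expComps p (m + 1) k * Real.exp (-(ε / 4) * p * k) := by
    intro m hm
    by_cases hk : k ≤ m
    · have h0 := expComps_succ_mul p hk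
      have hm1 : (0 : ℝ) < m + 1 := by positivity
      have hq : 0 < 1 - p := by linarith
      have hA := expComps_nonneg hp.le hp1 (m + 1) k
      have hmN : ((m : ℝ) + 1) * p ≤ 1 - ε / 2 := by
        have : ((m : ℝ) + 1) ≤ N := by exact_mod_cast hm
        nlinarith
      have h1 : ((m : ℝ) + 1 - k) ≤ (m + 1) * (1 - p) ^ k * Real.exp (-(ε / 4) * p * k) := by
        have e1 : Real.exp (-(p * (1 + 2 * p))) ^ k ≤ (1 - p) ^ k :=
          pow_le_pow_left₀ (Real.exp_pos _).le (exp_neg_le_one_sub (by linarith)) k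
        rw [← Real.exp_nat_mul] at e1
        have e2 : 1 - (k : ℝ) / (m + 1) ≤ Real.exp (-((k : ℝ) / (m + 1))) :=
          Real.one_sub_le_exp_neg _
        have e3 : p * (1 + ε / 2) ≤ 1 / (m + 1) := by
          rw [le_div_iff₀ hm1]
          nlinarith
        have e4 : Real.exp (-((k : ℝ) / (m + 1))) ≤
            Real.exp (k * (-(p * (1 + 2 * p)))) * Real.exp (-(ε / 4) * p * k) := by
          rw [← Real.exp_add, Real.exp_le_exp]
          have : (k : ℝ) / (m + 1) = k * (1 / (m + 1)) := by ring
          rw [this]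
          have hk0 : (0 : ℝ) ≤ k := Nat.cast_nonneg k
          have : k * (p * (1 + ε / 2)) ≤ k * (1 / ((m : ℝ) + 1)) :=
            mul_le_mul_of_nonneg_left e3 hk0
          have : (k : ℝ) * p * p ≤ k * p * (ε / 8) :=
            mul_le_mul_of_nonneg_left hpε (by positivity)
          nlinarith
        have e5 : 1 - (k : ℝ) / (m + 1) ≤ (1 - p) ^ k * Real.exp (-(ε / 4) * p * k) :=
          e2.trans (e4.trans (mul_le_mul_of_nonneg_right e1 (Real.exp_pos _).le))
        calc ((m : ℝ) + 1 - k) = (m + 1) * (1 - (k : ℝ) / (m + 1)) := by field_simp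
          _ ≤ _ := by rw [mul_assoc]; exact mul_le_mul_of_nonneg_left e5 hm1.le
      have h2 := mul_le_mul_of_nonneg_left h1 hA
      rw [h0] at h2
      have h3 : 0 < (m + 1) * (1 - p) ^ k := by positivity
      refine le_of_mul_le_mul_right ?_ h3
      linarith
    · rw [expComps_eq_zero p (not_le.1 hk)]
      exact mul_nonneg (expComps_nonneg hp.le hp1 _ _) (Real.exp_pos _).le
  have iter : ∀ j, n + j ≤ N →
      expComps p n k ≤ expComps p (n + j) k * Real.exp (-(ε / 4) * p * k * j) := by
    intro j
    induction j with
    | zero => simp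
    | succ j ih =>
      intro hj
      refine (ih (by omega)).trans ?_
      have := mul_le_mul_of_nonneg_right (step (n + j) (by omega))
        (Real.exp_pos (-(ε / 4) * p * k * j)).le
      rw [mul_assoc (expComps _ _ _), ← Real.exp_add] at this
      rw [← add_assoc]
      convert this using 3
      push_cast
      ring
  have hnN : n ≤ N := by
    refine Nat.le_floor ?_
    rw [le_div_iff₀ hp]
    linarith
  have h1 := iter (N - n) (by omega)
  rw [Nat.add_sub_cancel' hnN, Nat.cast_sub hnN] at h1
  have h2 : -(ε / 4) * p * k * ((N : ℝ) - n) ≤ -(ε ^ 2 / 16) * k := by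
    have : ε / 4 ≤ p * ((N : ℝ) - n) := by linarith
    have hk0 : (0 : ℝ) ≤ ε / 4 * k := by positivity
    nlinarith [mul_le_mul_of_nonneg_left this hk0]
  have h3 : (k : ℝ) * expComps p N k ≤ p⁻¹ := by
    refine (mul_expComps_le hp.le hp1 N k).trans ?_
    rw [← one_div, le_div_iff₀ hp]
    linarith
  calc (k : ℝ) * expComps p n k
      ≤ k * (expComps p N k * Real.exp (-(ε / 4) * p * k * ((N : ℝ) - n))) :=
        mul_le_mul_of_nonneg_left h1 (Nat.cast_nonneg _)
    _ = (k * expComps p N k) * Real.exp (-(ε / 4) * p * k * ((N : ℝ) - n)) := by ring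
    _ ≤ _ := mul_le_mul h3 (Real.exp_le_exp.2 h2) (Real.exp_pos _).le (by positivity)

lemma neg_log_one_sub_le {x y : ℝ} (hx : 0 ≤ x) (hxy : x ≤ y) (hy : 0 < y) (hy1 : y < 1) :
    -Real.log (1 - x) ≤ -Real.log (1 - y) / y * x := by
  have hmem : (1 - y) ∈ Set.Ioi (0 : ℝ) := by simpa using hy1
  have ha : 0 ≤ 1 - x / y := by rw [sub_nonneg, div_le_one hy]; exact hxy
  have h := strictConcaveOn_log_Ioi.concaveOn.2 (Set.mem_Ioi.2 one_pos) hmem ha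
    (div_nonneg hx hy.le) (sub_add_cancel _ _)
  simp only [Real.log_one, smul_eq_mul, mul_zero, zero_add, mul_one] at h
  have h2 : 1 - x / y + x / y * (1 - y) = 1 - x := by field_simp; ring
  rw [h2] at h
  have h3 : -Real.log (1 - y) / y * x = -(x / y * Real.log (1 - y)) := by ring
  rw [h3]
  linarith

/-- Below a threshold larger than `1 - 1 / λ`, lowering the number of vertices increases the
expected number of components by a factor exponential in the size. -/
lemma exists_expComps_le_of_supercritical {lam : ℝ} (hlam : 1 < lam) :
    ∃ κ c : ℝ, 1 - 1 / lam < κ ∧ κ < 1 ∧ 0 < c ∧ ∀ᶠ n : ℕ in Filter.atTop,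
      ∃ m ≤ n, ∀ k : ℕ, (k : ℝ) ≤ κ * n →
        expComps (lam / n) n k ≤ Real.exp (-c * k) * expComps (lam / n) m k := by
  have hl0 : 0 < lam := by linarith
  set x₀ : ℝ := 1 - 1 / lam with hx₀
  have hx₀pos : 0 < x₀ := by
    rw [hx₀, sub_pos, div_lt_one hl0]; exact hlam
  have hx₀lt : x₀ < 1 := by
    rw [hx₀]; have : 0 < 1 / lam := by positivity
    linarith
  have hpos : 0 < lam * x₀ + Real.log (1 - x₀) := by
    have h1 : lam * x₀ = lam - 1 := by rw [hx₀]; field_simp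
    have h2 : 1 - x₀ = lam⁻¹ := by rw [hx₀]; simp
    rw [h1, h2, Real.log_inv]
    have := Real.log_lt_sub_one_of_pos hl0 hlam.ne'
    linarith
  have hcont : ContinuousAt (fun x => lam * x + Real.log (1 - x)) x₀ := by
    refine ContinuousAt.add (by fun_prop) (ContinuousAt.log (by fun_prop) (by linarith))
  have hev : ∀ᶠ x in nhds x₀, 0 < lam * x + Real.log (1 - x) ∧ x < 1 :=
    (hcont.eventually (lt_mem_nhds hpos)).and (gt_mem_nhds hx₀lt)
  obtain ⟨y, hy, hxy⟩ := ((hev.filter_mono nhdsWithin_le_nhds).and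
    (self_mem_nhdsWithin (s := Set.Ioi x₀))).exists
  obtain ⟨hy, hy1⟩ := hy
  have hxy : x₀ < y := hxy
  have hy0 : 0 < y := hx₀pos.trans hxy
  set L := -Real.log (1 - y) / y with hL
  have hL0 : 0 < L := by
    have : Real.log (1 - y) < 0 := Real.log_neg (by linarith) (by linarith)
    rw [hL]; apply div_pos <;> linarith
  have hLlam : L < lam := by rw [hL, div_lt_iff₀ hy0]; linarith
  obtain ⟨μ, hμ, hμ1⟩ := exists_between (show max (L / lam) (x₀ / y) < 1 from
    max_lt ((div_lt_one hl0).2 hLlam) ((div_lt_one hy0).2 hxy))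
  have hμL : L / lam < μ := (le_max_left _ _).trans_lt hμ
  have hμx : x₀ / y < μ := (le_max_right _ _).trans_lt hμ
  have hμ0 : 0 < μ := (div_pos hx₀pos hy0).trans hμx
  obtain ⟨κ, hκ, hκ1⟩ := exists_between ((div_lt_iff₀ hy0).1 hμx)
  have hc₀ : 0 < lam - L / μ := by
    rw [div_lt_iff₀ hl0] at hμL
    rw [sub_pos, div_lt_iff₀ hμ0]
    linarith
  refine ⟨κ, (lam - L / μ) * ((1 - μ) / 2), hκ, by nlinarith,
    mul_pos hc₀ (by linarith), ?_⟩
  filter_upwards [Filter.eventually_ge_atTop ⌈2 / (1 - μ)⌉₊, Filter.eventually_ge_atTop ⌈lam⌉₊,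
    Filter.eventually_gt_atTop 0] with n hn hnlam hn0
  have hn : 2 / (1 - μ) ≤ n := Nat.ceil_le.1 hn
  have hnlam : lam ≤ n := Nat.ceil_le.1 hnlam
  have hnpos : (0 : ℝ) < n := by exact_mod_cast hn0
  have hp : 0 < lam / n := by positivity
  have hp1 : lam / n ≤ 1 := (div_le_one hnpos).2 hnlam
  set m₀ := ⌈μ * n⌉₊ with hm₀
  have hm₀le : m₀ ≤ n := Nat.ceil_le.2 (by nlinarith)
  have hm₀ge : μ * n ≤ m₀ := Nat.le_ceil _
  refine ⟨m₀, hm₀le, fun k hk => ?_⟩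
  have hkm : k ≤ m₀ := by
    have : (k : ℝ) ≤ m₀ := by nlinarith
    exact_mod_cast this
  have step : ∀ m, m₀ ≤ m →
      expComps (lam / n) (m + 1) k ≤
        expComps (lam / n) m k * Real.exp (-((lam - L / μ) * k / n)) := by
    intro m hm
    have hm1 : (0 : ℝ) < m + 1 := by positivity
    have hmμ : μ * n ≤ m + 1 := by
      have : (m₀ : ℝ) ≤ m := by exact_mod_cast hm
      linarith
    set x := (k : ℝ) / (m + 1) with hx
    have hx0 : 0 ≤ x := by positivity
    have hkμ : x ≤ (k : ℝ) / (μ * n) :=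
      div_le_div_of_nonneg_left (Nat.cast_nonneg k) (by positivity) hmμ
    have hxle : x ≤ y := by
      refine hkμ.trans ?_
      rw [div_le_iff₀ (by positivity)]
      nlinarith
    have h1 := neg_log_one_sub_le hx0 hxle hy0 hy1
    have h2 : L * x ≤ L / μ * k / n := by
      calc L * x ≤ L * ((k : ℝ) / (μ * n)) := mul_le_mul_of_nonneg_left hkμ hL0.le
        _ = L / μ * k / n := by field_simp
    have h3 : (1 - lam / n) ^ k ≤ Real.exp (-(lam * k / n)) := by
      calc (1 - lam / n) ^ k ≤ Real.exp (-(lam / n)) ^ k :=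
            pow_le_pow_left₀ (by linarith) (Real.one_sub_le_exp_neg _) k
        _ = _ := by rw [← Real.exp_nat_mul]; congr 1; ring
    have hx1 : 0 < 1 - x := by linarith
    have h4 : Real.exp (-(lam * k / n)) ≤ (1 - x) * Real.exp (-((lam - L / μ) * k / n)) := by
      conv_rhs => rw [← Real.exp_log hx1]
      rw [← Real.exp_add, Real.exp_le_exp]
      have : (lam - L / μ) * k / n = lam * k / n - L / μ * k / n := by ring
      rw [this]
      linarith
    have h5 := expComps_succ_mul (lam / n) (hkm.trans hm)
    have h6 : (m : ℝ) + 1 - k = (m + 1) * (1 - x) := by rw [hx]; field_simp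
    have hA := expComps_nonneg hp.le hp1 m k
    have h7 : 0 < (m : ℝ) + 1 - k := by rw [h6]; positivity
    refine le_of_mul_le_mul_right ?_ h7
    rw [h5, h6]
    have := mul_le_mul_of_nonneg_left (h3.trans h4) (mul_nonneg hA hm1.le)
    linarith
  have iter : ∀ j, expComps (lam / n) (m₀ + j) k ≤
      expComps (lam / n) m₀ k * Real.exp (-((lam - L / μ) * k / n) * j) := by
    intro j
    induction j with
    | zero => simp
    | succ j ih =>
      refine (step (m₀ + j) (by omega)).trans ?_
      refine (mul_le_mul_of_nonneg_right ih (Real.exp_pos _).le).trans (le_of_eq ?_)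
      rw [mul_assoc, ← Real.exp_add]
      congr 2
      push_cast
      ring
  have h1 := iter (n - m₀)
  rw [Nat.add_sub_cancel' hm₀le, Nat.cast_sub hm₀le] at h1
  refine h1.trans ?_
  rw [mul_comm]
  refine mul_le_mul_of_nonneg_right (Real.exp_le_exp.2 ?_) (expComps_nonneg hp.le hp1 _ _)
  have h2 : (1 - μ) / 2 * n ≤ (n : ℝ) - m₀ := by
    have : (m₀ : ℝ) < μ * n + 1 := Nat.ceil_lt_add_one (by positivity)
    rw [div_le_iff₀ (by linarith)] at hn
    linarith
  have h3 : (1 - μ) / 2 ≤ ((n : ℝ) - m₀) / n := by rwa [le_div_iff₀ hnpos]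
  have h4 : -((lam - L / μ) * k / n) * ((n : ℝ) - m₀) =
      -((lam - L / μ) * k) * (((n : ℝ) - m₀) / n) := by field_simp
  rw [h4]
  have := mul_le_mul_of_nonneg_left h3 (show 0 ≤ (lam - L / μ) * k by positivity)
  linarith

/-! ### Components of size at most `√n` -/

/-- The expected number of vertices in components of size `k ≤ √n` decays exponentially in `k`. -/
def SmallCompDecay (lam C c : ℝ) : Prop :=
  ∀ᶠ n : ℕ in Filter.atTop, ∀ k : ℕ, k * k ≤ n →
    k * expComps (lam / n) n k ≤ C * n * Real.exp (-c * k)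

/-- The limiting probability that a given vertex lies in a component of size `k`. -/
noncomputable def treeLimit (lam : ℝ) (k : ℕ) : ℝ :=
  treeCount k * lam ^ (k - 1) / (k - 1).factorial * Real.exp (-lam * k)

lemma treeLimit_nonneg {lam : ℝ} (hlam : 0 < lam) (k : ℕ) : 0 ≤ treeLimit lam k := by
  unfold treeLimit; positivity

lemma exp_le_one_add_mul_exp (x : ℝ) : Real.exp x ≤ 1 + x * Real.exp x := by
  have h1 := Real.one_sub_le_exp_neg x
  have h2 := mul_le_mul_of_nonneg_right h1 (Real.exp_pos x).le
  rw [← Real.exp_add, neg_add_cancel, Real.exp_zero] at h2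
  linarith

lemma mul_choose_eq {n k : ℕ} (hk : 1 ≤ k) (hkn : k ≤ n) :
    (k : ℝ) * n.choose k = n * (n - 1).choose (k - 1) := by
  obtain ⟨k, rfl⟩ := Nat.exists_eq_add_of_le' hk
  obtain ⟨n, rfl⟩ := Nat.exists_eq_add_of_le' (hk.trans hkn)
  have := Nat.add_one_mul_choose_eq n k
  simp only [Nat.add_sub_cancel]
  rw [mul_comm]
  exact_mod_cast this.symm

lemma mul_expComps_le_treeLimit {lam : ℝ} (hlam : 0 < lam) {n k : ℕ} (hn : lam ≤ n) (hk : 1 ≤ k)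
    (hkn : k * k ≤ n) :
    k * expComps (lam / n) n k ≤ n * treeLimit lam k * Real.exp (lam * k ^ 2 / n) := by
  have hkn' : k ≤ n := by nlinarith
  have hn0 : (0 : ℝ) < n := by linarith
  have hp : 0 ≤ lam / n := by positivity
  have hp1 : lam / n ≤ 1 := (div_le_one hn0).2 hn
  have h1 : (((n - 1).choose (k - 1) : ℕ) : ℝ) ≤ (n : ℝ) ^ (k - 1) / (k - 1).factorial := by
    refine (Nat.choose_le_pow_div (k - 1) (n - 1)).trans ?_
    gcongr
    exact Nat.sub_le _ _
  have h2 := connProb_le hp hp1 k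
  have h3 : (1 - lam / n) ^ (k * (n - k)) ≤
      Real.exp (-lam * k) * Real.exp (lam * k ^ 2 / n) := by
    calc (1 - lam / n) ^ (k * (n - k)) ≤ Real.exp (-(lam / n)) ^ (k * (n - k)) :=
          pow_le_pow_left₀ (by linarith) (Real.one_sub_le_exp_neg _) _
      _ = _ := by
        rw [← Real.exp_nat_mul, ← Real.exp_add]
        congr 1
        push_cast [Nat.cast_sub hkn']
        field_simp
        ring
  have hc := connProb_nonneg hp hp1 k
  have hq : 0 ≤ 1 - lam / n := by linarith
  calc k * expComps (lam / n) n k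
      = n * (((n - 1).choose (k - 1) : ℕ) : ℝ) *
          (connProb (lam / n) k * (1 - lam / n) ^ (k * (n - k))) := by
        rw [← mul_choose_eq hk hkn', expComps]; ring
    _ ≤ n * ((n : ℝ) ^ (k - 1) / (k - 1).factorial) *
          ((treeCount k * (lam / n) ^ (k - 1)) *
            (Real.exp (-lam * k) * Real.exp (lam * k ^ 2 / n))) := by
        gcongr
    _ = n * treeLimit lam k * Real.exp (lam * k ^ 2 / n) := by
        rw [treeLimit, div_pow]
        field_simp

lemma treeLimit_le_mul_expComps {lam : ℝ} (hlam : 0 < lam) {n k : ℕ} (hn : 2 * lam ≤ n)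
    (hk : 1 ≤ k) (hkn : k * k ≤ n) :
    n * treeLimit lam k * (1 - (1 + 2 * lam ^ 2) * k ^ 2 / n) ≤
      k * expComps (lam / n) n k := by
  have hkn' : k ≤ n := by nlinarith
  have hn0 : (0 : ℝ) < n := by linarith
  have hn1 : 1 ≤ n := hk.trans hkn'
  have hp : 0 ≤ lam / n := by positivity
  have hp1 : lam / n ≤ 1 / 2 := by rw [div_le_iff₀ hn0]; linarith
  have hk1 : (1 : ℝ) ≤ k := by exact_mod_cast hk
  have hkk : (k : ℝ) ^ 2 / n ≤ 1 := by
    rw [div_le_one hn0, sq]; exact_mod_cast hkn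
  have hkdiv : (k : ℝ) / n ≤ 1 := by rw [div_le_one hn0]; exact_mod_cast hkn'
  have h1 : (n : ℝ) ^ (k - 1) / (k - 1).factorial * (1 - k ^ 2 / n) ≤
      (((n - 1).choose (k - 1) : ℕ) : ℝ) := by
    have e1 : (n - k + 1) ^ (k - 1) ≤ (n - 1).descFactorial (k - 1) := by
      have := Nat.pow_sub_le_descFactorial (n - 1) (k - 1)
      have h : n - 1 + 1 - (k - 1) = n - k + 1 := by omega
      rwa [h] at this
    rw [Nat.descFactorial_eq_factorial_mul_choose] at e1
    have e2 : ((n : ℝ) - k) ^ (k - 1) ≤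
        (k - 1).factorial * (((n - 1).choose (k - 1) : ℕ) : ℝ) := by
      calc ((n : ℝ) - k) ^ (k - 1) = (((n - k : ℕ)) : ℝ) ^ (k - 1) := by
            rw [Nat.cast_sub hkn']
        _ ≤ (((n - k + 1 : ℕ)) : ℝ) ^ (k - 1) := by gcongr; omega
        _ ≤ _ := by exact_mod_cast e1
    have e3 : 1 - (k : ℝ) ^ 2 / n ≤ (1 - k / n) ^ (k - 1) := by
      have b := one_add_mul_le_pow (show (-2 : ℝ) ≤ -((k : ℝ) / n) by linarith) k
      have : (1 - (k : ℝ) / n) ^ k ≤ (1 - k / n) ^ (k - 1) :=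
        pow_le_pow_of_le_one (by linarith) (by linarith [show 0 ≤ (k : ℝ) / n by positivity])
          (Nat.sub_le _ _)
      refine le_trans (le_of_eq ?_) (b.trans ((le_of_eq ?_).trans this))
      · ring
      · ring
    have e4 : (n : ℝ) ^ (k - 1) * (1 - k / n) ^ (k - 1) = ((n : ℝ) - k) ^ (k - 1) := by
      rw [← mul_pow]; congr 1; field_simp
    rw [div_mul_eq_mul_div, div_le_iff₀ (by positivity), mul_comm (((n - 1).choose _ : ℕ) : ℝ)]
    refine le_trans ?_ e2
    rw [← e4]
    exact mul_le_mul_of_nonneg_left e3 (by positivity)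
  have h2 := le_connProb hp (by linarith) k
  have h3 : Real.exp (-lam * k) * (1 - 2 * lam ^ 2 * k / n) ≤
      (1 - lam / n) ^ (k * k) * (1 - lam / n) ^ (k * (n - k)) := by
    rw [← pow_add]
    have h : k * k + k * (n - k) = k * n := by rw [← mul_add]; congr 1; omega
    rw [h]
    calc Real.exp (-lam * k) * (1 - 2 * lam ^ 2 * k / n)
        ≤ Real.exp (-lam * k) * Real.exp (-(2 * lam ^ 2 * k / n)) := by
          gcongr; exact Real.one_sub_le_exp_neg _
      _ = Real.exp (-(lam / n * (1 + 2 * (lam / n)))) ^ (k * n) := by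
          rw [← Real.exp_nat_mul, ← Real.exp_add]
          congr 1
          push_cast
          field_simp
          ring
      _ ≤ _ := pow_le_pow_left₀ (Real.exp_pos _).le (exp_neg_le_one_sub hp1) _
  have hq : 0 ≤ 1 - lam / n := by linarith
  have hkk' : 0 ≤ 1 - (k : ℝ) ^ 2 / n := by linarith
  calc n * treeLimit lam k * (1 - (1 + 2 * lam ^ 2) * k ^ 2 / n)
      ≤ n * treeLimit lam k * ((1 - k ^ 2 / n) * (1 - 2 * lam ^ 2 * k / n)) := by
        have := treeLimit_nonneg hlam k
        refine mul_le_mul_of_nonneg_left ?_ (by positivity)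
        have a1 : 2 * lam ^ 2 * k / n ≤ 2 * lam ^ 2 * k ^ 2 / n := by
          gcongr; nlinarith
        have a2 : 0 ≤ (k : ℝ) ^ 2 / n * (2 * lam ^ 2 * k / n) := by positivity
        have a3 : (1 + 2 * lam ^ 2) * (k : ℝ) ^ 2 / n = k ^ 2 / n + 2 * lam ^ 2 * k ^ 2 / n := by
          ring
        rw [a3]
        linarith
    _ = n * ((n : ℝ) ^ (k - 1) / (k - 1).factorial * (1 - k ^ 2 / n)) *
          ((treeCount k * (lam / n) ^ (k - 1)) *
            (Real.exp (-lam * k) * (1 - 2 * lam ^ 2 * k / n))) := by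
        rw [treeLimit, div_pow]
        field_simp
    _ ≤ n * (((n - 1).choose (k - 1) : ℕ) : ℝ) *
          ((treeCount k * (lam / n) ^ (k - 1)) *
            ((1 - lam / n) ^ (k * k) * (1 - lam / n) ^ (k * (n - k)))) := by
        refine (mul_le_mul_of_nonneg_left (mul_le_mul_of_nonneg_left h3 (by positivity))
          (by positivity)).trans ?_
        gcongr
    _ ≤ n * (((n - 1).choose (k - 1) : ℕ) : ℝ) *
          (connProb (lam / n) k * (1 - lam / n) ^ (k * (n - k))) := by
        rw [← mul_assoc (_ * _) ((1 - lam / n) ^ (k * k))]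
        gcongr
    _ = k * expComps (lam / n) n k := by
        rw [← mul_choose_eq hk hkn', expComps]; ring

lemma abs_mul_expComps_sub_le {lam : ℝ} (hlam : 0 < lam) {n k : ℕ} (hn : 2 * lam ≤ n)
    (hkn : k * k ≤ n) :
    |k * expComps (lam / n) n k - n * treeLimit lam k| ≤
      (lam * Real.exp lam + 1 + 2 * lam ^ 2) * k ^ 2 * treeLimit lam k := by
  have hb := treeLimit_nonneg hlam k
  have hn0 : (0 : ℝ) < n := by linarith
  rcases Nat.eq_zero_or_pos k with rfl | hk
  · have : treeLimit lam 0 = 0 := by simp [treeLimit, treeCount]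
    simp [this]
  have h1 := mul_expComps_le_treeLimit hlam (by linarith) hk hkn
  have h2 := treeLimit_le_mul_expComps hlam hn hk hkn
  set b := treeLimit lam k
  have hx : lam * (k : ℝ) ^ 2 / n ≤ lam := by
    rw [div_le_iff₀ hn0]
    gcongr
    rw [sq]; exact_mod_cast hkn
  have h3 : Real.exp (lam * k ^ 2 / n) ≤ 1 + lam * k ^ 2 / n * Real.exp lam := by
    refine (exp_le_one_add_mul_exp _).trans ?_
    gcongr
  have h4 : n * b * Real.exp (lam * k ^ 2 / n) ≤ n * b + lam * Real.exp lam * k ^ 2 * b := by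
    refine (mul_le_mul_of_nonneg_left h3 (by positivity)).trans (le_of_eq ?_)
    field_simp
  have h5 : n * b * (1 - (1 + 2 * lam ^ 2) * k ^ 2 / n) =
      n * b - (1 + 2 * lam ^ 2) * k ^ 2 * b := by
    field_simp
  rw [h5] at h2
  have e1 : 0 ≤ lam * Real.exp lam * k ^ 2 * b := by positivity
  have e2 : 0 ≤ (1 + 2 * lam ^ 2) * k ^ 2 * b := by positivity
  rw [abs_le]
  constructor <;> nlinarith

lemma treeLimit_le {lam C c : ℝ} (hlam : 0 < lam) (h : SmallCompDecay lam C c) (k : ℕ) :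
    treeLimit lam k ≤ 2 * C * Real.exp (-c * k) := by
  set D := (lam * Real.exp lam + 1 + 2 * lam ^ 2) * (k : ℝ) ^ 2 with hD
  obtain ⟨n, hn, h1, h2, h3⟩ := (h.and ((Filter.eventually_ge_atTop ⌈2 * lam⌉₊).and
    ((Filter.eventually_ge_atTop (k * k)).and
      (Filter.eventually_ge_atTop ⌈2 * D⌉₊)))).exists
  have h1 : 2 * lam ≤ n := Nat.ceil_le.1 h1
  have h3 : 2 * D ≤ n := Nat.ceil_le.1 h3
  have hn0 : (0 : ℝ) < n := by linarith
  have h4 := (abs_le.1 (abs_mul_expComps_sub_le hlam h1 h2)).1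
  have h5 := hn k h2
  have hb := treeLimit_nonneg hlam k
  have h6 : (n : ℝ) * treeLimit lam k ≤ n * (2 * C * Real.exp (-c * k)) := by
    nlinarith [mul_le_mul_of_nonneg_right h3 hb]
  exact le_of_mul_le_mul_left h6 hn0

lemma summable_pow_mul_treeLimit {lam C c : ℝ} (hlam : 0 < lam) (hc : 0 < c)
    (h : SmallCompDecay lam C c) (j : ℕ) : Summable fun k : ℕ => (k : ℝ) ^ j * treeLimit lam k := by
  refine Summable.of_nonneg_of_le (fun k => mul_nonneg (by positivity) (treeLimit_nonneg hlam k))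
    (fun k => mul_le_mul_of_nonneg_left (treeLimit_le hlam h k) (by positivity)) ?_
  have := (Real.summable_pow_mul_exp_neg_nat_mul j hc).mul_left (2 * C)
  refine this.congr fun k => by ring

/-- Truncation of a function of the component size at `√n`. -/
noncomputable def sqrtTrunc (n : ℕ) (g : ℕ → ℝ) (k : ℕ) : ℝ := if k * k ≤ n then g k else 0

/-- The sum of `g |C(v)|` over the vertices `v` with `|C(v)| ≤ √n`. -/
noncomputable def smallSum (n : ℕ) (g : ℕ → ℝ) (E : Finset (Fin n × Fin n)) : ℝ :=
  ∑ W : Finset (Fin n), (W.card * sqrtTrunc n g W.card) * compInd W E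

lemma perc_smallSum (p : ℝ) (n : ℕ) (g : ℕ → ℝ) :
    perc p (allPairs n) (smallSum n g) =
      ∑ k ∈ range (n + 1), (k * sqrtTrunc n g k) * expComps p n k :=
  perc_sum_compInd p n fun k => k * sqrtTrunc n g k

lemma exists_perc_smallSum_sub_le {lam C c : ℝ} (hlam : 0 < lam) (hc : 0 < c)
    (h : SmallCompDecay lam C c) :
    ∃ γ K : ℝ, 0 < γ ∧ ∀ᶠ n : ℕ in Filter.atTop,
      |perc (lam / n) (allPairs n) (smallSum n fun k => k) - γ * n| ≤ K := by
  have hs1 := summable_pow_mul_treeLimit hlam hc h 1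
  have hs3 := summable_pow_mul_treeLimit hlam hc h 3
  simp only [pow_one] at hs1
  have hnn1 : ∀ k : ℕ, 0 ≤ (k : ℝ) * treeLimit lam k :=
    fun k => mul_nonneg (by positivity) (treeLimit_nonneg hlam k)
  have hnn3 : ∀ k : ℕ, 0 ≤ (k : ℝ) ^ 3 * treeLimit lam k :=
    fun k => mul_nonneg (by positivity) (treeLimit_nonneg hlam k)
  set D := lam * Real.exp lam + 1 + 2 * lam ^ 2 with hD
  have hD0 : 0 ≤ D := by positivity
  set M := ∑' k : ℕ, (k : ℝ) ^ 3 * treeLimit lam k with hM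
  refine ⟨∑' k : ℕ, (k : ℝ) * treeLimit lam k, (D + 1) * M, ?_, ?_⟩
  · refine hs1.tsum_pos hnn1 1 ?_
    have := treeCount_one_pos
    simp only [treeLimit]
    positivity
  filter_upwards [Filter.eventually_ge_atTop ⌈2 * lam⌉₊] with n hn
  have hn : 2 * lam ≤ n := Nat.ceil_le.1 hn
  have hn0 : (0 : ℝ) < n := by linarith
  set S := (range (n + 1)).filter fun k => k * k ≤ n with hS
  have hsum : perc (lam / n) (allPairs n) (smallSum n fun k => k) =
      ∑ k ∈ S, (k : ℝ) * (k * expComps (lam / n) n k) := by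
    rw [perc_smallSum, hS, Finset.sum_filter]
    refine Finset.sum_congr rfl fun k _ => ?_
    unfold sqrtTrunc
    split_ifs <;> ring
  have h1 : |∑ k ∈ S, (k : ℝ) * (k * expComps (lam / n) n k) -
      ∑ k ∈ S, n * ((k : ℝ) * treeLimit lam k)| ≤ D * M := by
    rw [← Finset.sum_sub_distrib]
    refine (Finset.abs_sum_le_sum_abs _ _).trans ?_
    rw [hM, ← tsum_mul_left]
    refine le_trans (Finset.sum_le_sum fun k hk => ?_)
      ((hs3.mul_left D).sum_le_tsum S fun k _ => mul_nonneg hD0 (hnn3 k))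
    have hk' : k * k ≤ n := (Finset.mem_filter.1 hk).2
    have := abs_mul_expComps_sub_le hlam hn hk'
    have e : (k : ℝ) * (k * expComps (lam / n) n k) - n * ((k : ℝ) * treeLimit lam k) =
        k * (k * expComps (lam / n) n k - n * treeLimit lam k) := by ring
    rw [e, abs_mul, Nat.abs_cast]
    refine (mul_le_mul_of_nonneg_left this (Nat.cast_nonneg k)).trans (le_of_eq ?_)
    ring
  have h2 : ∑ k ∈ S, n * ((k : ℝ) * treeLimit lam k) ≤
      (∑' k : ℕ, (k : ℝ) * treeLimit lam k) * n := by
    rw [mul_comm, ← tsum_mul_left]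
    exact (hs1.mul_left (n : ℝ)).sum_le_tsum S fun k _ => mul_nonneg hn0.le (hnn1 k)
  have h3 : (∑' k : ℕ, (k : ℝ) * treeLimit lam k) * n ≤
      ∑ k ∈ S, n * ((k : ℝ) * treeLimit lam k) + M := by
    have hfin : HasSum (fun k : ℕ => if k ∈ S then n * ((k : ℝ) * treeLimit lam k) else 0)
        (∑ k ∈ S, n * ((k : ℝ) * treeLimit lam k)) := by
      have : HasSum (fun k : ℕ => if k ∈ S then n * ((k : ℝ) * treeLimit lam k) else 0)
          (∑ k ∈ S, if k ∈ S then n * ((k : ℝ) * treeLimit lam k) else 0) :=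
        hasSum_sum_of_ne_finset_zero fun b hb => by simp [hb]
      rwa [Finset.sum_congr rfl fun k hk => if_pos hk] at this
    rw [mul_comm]
    refine hasSum_le (fun k => ?_) (hs1.hasSum.mul_left (n : ℝ)) (hfin.add hs3.hasSum)
    split_ifs with hk
    · linarith [hnn3 k]
    · have hlt : n ≤ k * k := by
        by_contra hcon
        refine hk (Finset.mem_filter.2 ⟨Finset.mem_range.2 ?_, by omega⟩)
        nlinarith
      have hlt : (n : ℝ) ≤ k * k := by exact_mod_cast hlt
      have := mul_le_mul_of_nonneg_right hlt (hnn1 k)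
      linarith
  rw [hsum]
  rw [abs_le] at h1 ⊢
  constructor <;> linarith

lemma exists_sum_pow_mul_expComps_le {lam C c : ℝ} (hc : 0 < c) (hC : 0 ≤ C)
    (h : SmallCompDecay lam C c) (j : ℕ) :
    ∃ K : ℝ, 0 ≤ K ∧ ∀ᶠ n : ℕ in Filter.atTop,
      ∑ k ∈ range (n + 1), sqrtTrunc n (fun k => (k : ℝ) ^ (j + 1)) k * expComps (lam / n) n k ≤
        K * n := by
  have hs := Real.summable_pow_mul_exp_neg_nat_mul j hc
  refine ⟨C * ∑' k : ℕ, (k : ℝ) ^ j * Real.exp (-c * k),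
    mul_nonneg hC (tsum_nonneg fun k => by positivity), ?_⟩
  filter_upwards [h] with n hn
  have h1 := (hs.mul_left (C * n)).sum_le_tsum (range (n + 1)) (fun k _ => by positivity)
  rw [tsum_mul_left] at h1
  refine le_trans (Finset.sum_le_sum fun k _ => ?_) (h1.trans (le_of_eq (by ring)))
  unfold sqrtTrunc
  split_ifs with hk
  · have := mul_le_mul_of_nonneg_left (hn k hk) (show (0 : ℝ) ≤ (k : ℝ) ^ j by positivity)
    calc _ = (k : ℝ) ^ j * (k * expComps (lam / n) n k) := by ring
      _ ≤ _ := this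
      _ = _ := by ring
  · rw [zero_mul]; positivity

lemma perc_compInd_mul_sub_le {lam : ℝ} (hlam : 0 < lam) {n : ℕ} (hn : 2 * lam ≤ n)
    {W W' : Finset (Fin n)} (hne : W ≠ W') (hW : W.card * W.card ≤ n)
    (hW' : W'.card * W'.card ≤ n) :
    perc (lam / n) (allPairs n) (fun E => compInd W E * compInd W' E) -
        perc (lam / n) (allPairs n) (compInd W) * perc (lam / n) (allPairs n) (compInd W') ≤
      2 * lam * Real.exp (2 * lam) / n *
        ((W.card * perc (lam / n) (allPairs n) (compInd W)) *
          (W'.card * perc (lam / n) (allPairs n) (compInd W'))) := by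
  have hn0 : (0 : ℝ) < n := by linarith
  have hp : 0 ≤ lam / n := by positivity
  have hp1 : lam / n ≤ 1 / 2 := by rw [div_le_iff₀ hn0]; linarith
  have hE : ∀ W : Finset (Fin n), 0 ≤ perc (lam / n) (allPairs n) (compInd W) := fun W =>
    perc_nonneg hp (by linarith) fun E _ => compInd_nonneg W E
  have hEW := hE W
  have hEW' := hE W'
  by_cases hd : Disjoint W W'
  · have e1 := perc_compInd (lam / n) W
    have e2 := perc_compInd (lam / n) W'
    rw [perc_compInd_mul _ hd]
    set k := W.card
    set l := W'.card
    have hkl : k + l ≤ n := by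
      rw [← Finset.card_union_of_disjoint hd]
      exact (Finset.card_le_univ _).trans (by simp)
    have hexp : k * (n - k) + l * (n - l) = k * (n - k) + l * (n - k - l) + k * l := by
      have : n - l = (n - k - l) + k := by omega
      rw [this]; ring
    have hprod : perc (lam / n) (allPairs n) (compInd W) *
        perc (lam / n) (allPairs n) (compInd W') =
        connProb (lam / n) k * connProb (lam / n) l *
          (1 - lam / n) ^ (k * (n - k) + l * (n - k - l)) * (1 - lam / n) ^ (k * l) := by
      calc _ = connProb (lam / n) k * connProb (lam / n) l *
          (1 - lam / n) ^ (k * (n - k) + l * (n - l)) := by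
            rw [pow_add, show perc (lam / n) (allPairs n) (compInd W) = _ from e1,
              show perc (lam / n) (allPairs n) (compInd W') = _ from e2]
            ring
        _ = _ := by rw [hexp, pow_add]; ring
    set X := connProb (lam / n) k * connProb (lam / n) l *
          (1 - lam / n) ^ (k * (n - k) + l * (n - k - l)) with hX
    have hX0 : 0 ≤ X := by
      have h1 := connProb_nonneg hp (by linarith) k
      have h2 := connProb_nonneg hp (by linarith) l
      have h3 : 0 ≤ 1 - lam / n := by linarith
      positivity
    set y := 2 * lam * (k * l) / n with hy
    have hy0 : 0 ≤ y := by positivity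
    have hkl2 : ((k : ℝ) * l) ≤ n := by
      have a : (k : ℝ) * k ≤ n := by exact_mod_cast hW
      have b : (l : ℝ) * l ≤ n := by exact_mod_cast hW'
      nlinarith [sq_nonneg ((k : ℝ) - l)]
    have hyle : y ≤ 2 * lam := by
      rw [hy, div_le_iff₀ hn0]
      gcongr
    have hpow : Real.exp (-y) ≤ (1 - lam / n) ^ (k * l) := by
      calc Real.exp (-y) = Real.exp (-(lam / n * 2)) ^ (k * l) := by
            rw [← Real.exp_nat_mul, hy]; congr 1; push_cast; ring
        _ ≤ Real.exp (-(lam / n * (1 + 2 * (lam / n)))) ^ (k * l) := by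
            refine pow_le_pow_left₀ (Real.exp_pos _).le (Real.exp_le_exp.2 ?_) _
            nlinarith
        _ ≤ _ := pow_le_pow_left₀ (Real.exp_pos _).le (exp_neg_le_one_sub hp1) _
    have hone : 1 ≤ (1 - lam / n) ^ (k * l) * (1 + y * Real.exp (2 * lam)) := by
      calc (1 : ℝ) = Real.exp (-y) * Real.exp y := by
            rw [← Real.exp_add, neg_add_cancel, Real.exp_zero]
        _ ≤ Real.exp (-y) * (1 + y * Real.exp (2 * lam)) := by
            refine mul_le_mul_of_nonneg_left ((exp_le_one_add_mul_exp y).trans ?_)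
              (Real.exp_pos _).le
            gcongr
        _ ≤ _ := mul_le_mul_of_nonneg_right hpow (by positivity)
    have hfin : X ≤ X * (1 - lam / n) ^ (k * l) * (1 + y * Real.exp (2 * lam)) := by
      have := mul_le_mul_of_nonneg_left hone hX0
      linarith
    have hrhs : 2 * lam * Real.exp (2 * lam) / n *
        ((k * perc (lam / n) (allPairs n) (compInd W)) *
          (l * perc (lam / n) (allPairs n) (compInd W'))) =
        y * Real.exp (2 * lam) * (X * (1 - lam / n) ^ (k * l)) := by
      rw [← hprod, hy]; ring
    rw [hrhs, hprod]
    linarith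
  · rw [perc_compInd_mul_eq_zero _ hne hd]
    have : 0 ≤ 2 * lam * Real.exp (2 * lam) / n *
        ((W.card * perc (lam / n) (allPairs n) (compInd W)) *
          (W'.card * perc (lam / n) (allPairs n) (compInd W'))) := by positivity
    have := mul_nonneg hEW hEW'
    linarith

lemma percVar_smallSum_le {lam : ℝ} (hlam : 0 < lam) {n : ℕ} (hn : 2 * lam ≤ n) {g : ℕ → ℝ}
    (hg : ∀ k, 0 ≤ g k) :
    percVar (lam / n) (allPairs n) (smallSum n g) ≤
      ∑ k ∈ range (n + 1), (k * sqrtTrunc n g k) ^ 2 * expComps (lam / n) n k +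
        2 * lam * Real.exp (2 * lam) / n *
          (∑ k ∈ range (n + 1), (k * sqrtTrunc n g k) * k * expComps (lam / n) n k) ^ 2 := by
  have hn0 : (0 : ℝ) < n := by linarith
  have hp : 0 ≤ lam / n := by positivity
  have hp1 : lam / n ≤ 1 := by rw [div_le_iff₀ hn0]; linarith
  set P := fun W : Finset (Fin n) => perc (lam / n) (allPairs n) (compInd W) with hP
  set w := fun W : Finset (Fin n) => (W.card : ℝ) * sqrtTrunc n g W.card with hw
  set D := 2 * lam * Real.exp (2 * lam) / n with hD
  have hP0 : ∀ W, 0 ≤ P W := fun W => perc_nonneg hp hp1 fun E _ => compInd_nonneg W E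
  have hD0 : 0 ≤ D := by positivity
  have hw0 : ∀ W, 0 ≤ w W := fun W => by
    have : 0 ≤ sqrtTrunc n g W.card := by unfold sqrtTrunc; split_ifs <;> simp [hg]
    positivity
  have e1 : ∑ k ∈ range (n + 1), (k * sqrtTrunc n g k) ^ 2 * expComps (lam / n) n k =
      ∑ W, w W ^ 2 * P W := by
    rw [← perc_sum_compInd (lam / n) n fun k => (k * sqrtTrunc n g k) ^ 2, perc_sum]
    simp only [perc_const_mul]
    rfl
  have e2 : ∑ k ∈ range (n + 1), (k * sqrtTrunc n g k) * k * expComps (lam / n) n k =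
      ∑ W, w W * (W.card * P W) := by
    rw [← perc_sum_compInd (lam / n) n fun k => (k * sqrtTrunc n g k) * k, perc_sum]
    simp only [perc_const_mul, mul_assoc, hw]
    rfl
  have e3 : perc (lam / n) (allPairs n) (smallSum n g) = ∑ W, w W * P W := by
    unfold smallSum
    rw [perc_sum]
    simp only [perc_const_mul]
    rfl
  have e4 : perc (lam / n) (allPairs n) (fun E => smallSum n g E ^ 2) =
      ∑ W, ∑ W', w W * w W' *
        perc (lam / n) (allPairs n) (fun E => compInd W E * compInd W' E) := by
    simp only [smallSum, sq, Finset.sum_mul_sum, perc_sum, ← perc_const_mul]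
    refine Finset.sum_congr rfl fun W _ => Finset.sum_congr rfl fun W' _ => ?_
    exact perc_congr fun E _ => by ring
  rw [percVar, e4, e3, e1, e2, sq (∑ W, w W * P W), sq (∑ W, w W * (W.card * P W)),
    Finset.sum_mul_sum, Finset.sum_mul_sum, ← Finset.sum_sub_distrib, Finset.mul_sum,
    ← Finset.sum_add_distrib]
  refine Finset.sum_le_sum fun W _ => ?_
  rw [← Finset.sum_sub_distrib, Finset.mul_sum]
  have hsingle : w W ^ 2 * P W = ∑ W', if W = W' then w W ^ 2 * P W else 0 := by simp
  rw [hsingle, ← Finset.sum_add_distrib]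
  refine Finset.sum_le_sum fun W' _ => ?_
  have hnn : 0 ≤ D * (w W * (W.card * P W) * (w W' * (W'.card * P W'))) := by
    have := hP0 W; have := hP0 W'; have := hw0 W; have := hw0 W'
    positivity
  split_ifs with hWW
  · subst hWW
    have : perc (lam / n) (allPairs n) (fun E => compInd W E * compInd W E) = P W := by
      simp only [compInd_sq, hP]
    rw [this]
    nlinarith [sq_nonneg (w W * P W)]
  · by_cases hW : W.card * W.card ≤ n
    · by_cases hW' : W'.card * W'.card ≤ n
      · have := mul_le_mul_of_nonneg_left (perc_compInd_mul_sub_le hlam hn hWW hW hW')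
          (mul_nonneg (hw0 W) (hw0 W'))
        calc _ = w W * w W' * (perc (lam / n) (allPairs n) (fun E => compInd W E * compInd W' E) -
              P W * P W') := by ring
          _ ≤ _ := this
          _ = _ := by simp only [hP, hD]; ring
      · have : w W' = 0 := by simp [hw, sqrtTrunc, hW']
        simp [this]
    · have : w W = 0 := by simp [hw, sqrtTrunc, hW]
      simp [this]

lemma exists_percVar_smallSum_le {lam C c : ℝ} (hlam : 0 < lam) (hc : 0 < c) (hC : 0 ≤ C)
    (h : SmallCompDecay lam C c) {g : ℕ → ℝ} (hg : ∀ k, 0 ≤ g k) (hg1 : ∀ k, 1 ≤ k → g k ≤ k) :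
    ∃ K : ℝ, 0 ≤ K ∧ ∀ᶠ n : ℕ in Filter.atTop,
      percVar (lam / n) (allPairs n) (smallSum n g) ≤ K * n := by
  obtain ⟨K₄, hK₄, h4⟩ := exists_sum_pow_mul_expComps_le hc hC h 3
  obtain ⟨K₃, hK₃, h3⟩ := exists_sum_pow_mul_expComps_le hc hC h 2
  refine ⟨K₄ + 2 * lam * Real.exp (2 * lam) * K₃ ^ 2, by positivity, ?_⟩
  filter_upwards [h4, h3, Filter.eventually_ge_atTop ⌈2 * lam⌉₊] with n h4 h3 hn
  have hn : 2 * lam ≤ n := Nat.ceil_le.1 hn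
  have hn0 : (0 : ℝ) < n := by linarith
  have hp : 0 ≤ lam / n := by positivity
  have hp1 : lam / n ≤ 1 := by rw [div_le_iff₀ hn0]; linarith
  have hgk : ∀ k : ℕ, k * g k ≤ (k : ℝ) ^ 2 := by
    intro k
    rcases Nat.eq_zero_or_pos k with rfl | hk
    · simp
    · rw [sq]; exact mul_le_mul_of_nonneg_left (hg1 k hk) (Nat.cast_nonneg k)
  have hA : ∑ k ∈ range (n + 1), (k * sqrtTrunc n g k) ^ 2 * expComps (lam / n) n k ≤ K₄ * n := by
    refine le_trans (Finset.sum_le_sum fun k _ => ?_) h4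
    refine mul_le_mul_of_nonneg_right ?_ (expComps_nonneg hp hp1 n k)
    unfold sqrtTrunc
    split_ifs
    · calc (k * g k) ^ 2 ≤ ((k : ℝ) ^ 2) ^ 2 :=
            pow_le_pow_left₀ (mul_nonneg (Nat.cast_nonneg _) (hg k)) (hgk k) 2
        _ = _ := by ring
    · simp
  have hB : ∑ k ∈ range (n + 1), (k * sqrtTrunc n g k) * k * expComps (lam / n) n k ≤ K₃ * n := by
    refine le_trans (Finset.sum_le_sum fun k _ => ?_) h3
    refine mul_le_mul_of_nonneg_right ?_ (expComps_nonneg hp hp1 n k)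
    unfold sqrtTrunc
    split_ifs
    · calc k * g k * k ≤ (k : ℝ) ^ 2 * k := mul_le_mul_of_nonneg_right (hgk k) (Nat.cast_nonneg k)
        _ = _ := by ring
    · simp
  have hB0 : 0 ≤ ∑ k ∈ range (n + 1), (k * sqrtTrunc n g k) * k * expComps (lam / n) n k := by
    refine Finset.sum_nonneg fun k _ => mul_nonneg ?_ (expComps_nonneg hp hp1 n k)
    unfold sqrtTrunc
    have := hg k
    split_ifs <;> positivity
  refine (percVar_smallSum_le hlam hn hg).trans ?_
  have hB2 := mul_le_mul_of_nonneg_left (pow_le_pow_left₀ hB0 hB 2)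
    (show 0 ≤ 2 * lam * Real.exp (2 * lam) / n by positivity)
  have e : 2 * lam * Real.exp (2 * lam) / n * (K₃ * n) ^ 2 =
      2 * lam * Real.exp (2 * lam) * K₃ ^ 2 * n := by field_simp
  rw [e] at hB2
  linarith

/-! ### Large components -/

lemma exists_pow_mul_sum_exp_le {c : ℝ} (hc : 0 < c) (a : ℕ) :
    ∃ K : ℝ, 0 ≤ K ∧ ∀ (n : ℕ) (s : Finset ℕ), (∀ k ∈ s, n < k * k) →
      (n : ℝ) ^ a * ∑ k ∈ s, Real.exp (-c * k) ≤ K := by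
  have hs := Real.summable_pow_mul_exp_neg_nat_mul (2 * a) hc
  refine ⟨∑' k : ℕ, (k : ℝ) ^ (2 * a) * Real.exp (-c * k),
    tsum_nonneg fun k => by positivity, fun n s hns => ?_⟩
  rw [Finset.mul_sum]
  refine le_trans (Finset.sum_le_sum fun k hk => ?_)
    (hs.sum_le_tsum s fun k _ => by positivity)
  have : (n : ℝ) ≤ (k : ℝ) ^ 2 := by rw [sq]; exact_mod_cast (hns k hk).le
  rw [pow_mul]
  gcongr

lemma expComps_le_mul_expComps {p : ℝ} (hp : 0 ≤ p) (hp1 : p ≤ 1) (n k : ℕ) :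
    expComps p n k ≤ k * expComps p n k := by
  rcases Nat.eq_zero_or_pos k with rfl | hk
  · simp [expComps_zero]
  · exact le_mul_of_one_le_left (expComps_nonneg hp hp1 n k) (by exact_mod_cast hk)

section pointwise
variable {n : ℕ} {E : Finset (Fin n × Fin n)}

lemma sumCompSq_eq (hE : E ⊆ allPairs n) :
    (sumCompSq E : ℝ) = ∑ W : Finset (Fin n), ((W.card : ℝ) * W.card) * compInd W E := by
  rw [← sum_compCard hE fun k => (k : ℝ)]
  simp [sumCompSq]

lemma sum_card_mul_compInd (hE : E ⊆ allPairs n) :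
    ∑ W : Finset (Fin n), (W.card : ℝ) * compInd W E = n := by
  have := sum_compCard hE fun _ => 1
  simp only [mul_one] at this
  rw [← this]
  simp

lemma sumCompSq_le : (sumCompSq E : ℝ) ≤ (n : ℝ) ^ 2 := by
  have h : sumCompSq E ≤ n * n := by
    calc sumCompSq E ≤ ∑ _v : Fin n, n := Finset.sum_le_sum fun v _ =>
          (Finset.card_le_univ _).trans (by simp)
      _ = n * n := by simp
  rw [sq]
  exact_mod_cast h

/-- The sum of `|C(v)|` over the vertices `v` with `|C(v)| > √n`. -/
noncomputable def largeSum (n : ℕ) (E : Finset (Fin n × Fin n)) : ℝ :=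
  ∑ W : Finset (Fin n), (if n < W.card * W.card then (W.card : ℝ) * W.card else 0) * compInd W E

lemma sumCompSq_eq_add (hE : E ⊆ allPairs n) :
    (sumCompSq E : ℝ) = smallSum n (fun k => k) E + largeSum n E := by
  rw [sumCompSq_eq hE, smallSum, largeSum, ← Finset.sum_add_distrib]
  refine Finset.sum_congr rfl fun W _ => ?_
  rw [← add_mul]
  congr 1
  unfold sqrtTrunc
  by_cases h : W.card * W.card ≤ n
  · simp [h, not_lt.2 h]
  · simp [h, not_le.1 h]

lemma smallSum_nonneg {g : ℕ → ℝ} (hg : ∀ k, 0 ≤ g k) : 0 ≤ smallSum n g E := by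
  refine Finset.sum_nonneg fun W _ => mul_nonneg (mul_nonneg (Nat.cast_nonneg _) ?_)
    (compInd_nonneg W E)
  unfold sqrtTrunc
  split_ifs <;> simp [hg]

lemma largeSum_nonneg : 0 ≤ largeSum n E := by
  refine Finset.sum_nonneg fun W _ => mul_nonneg ?_ (compInd_nonneg W E)
  split_ifs <;> positivity

lemma largeSum_le (hE : E ⊆ allPairs n) : largeSum n E ≤ (n : ℝ) ^ 2 := by
  have h1 := sumCompSq_eq_add hE
  have h2 := smallSum_nonneg (E := E) (g := fun k => (k : ℝ)) fun k => Nat.cast_nonneg k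
  have h3 := sumCompSq_le (E := E)
  linarith

lemma le_sum_mul_compInd {h : ℕ → ℝ} (hh : ∀ k, 0 ≤ h k) {W : Finset (Fin n)}
    (hW : IsCompSet W E) : h W.card ≤ ∑ W : Finset (Fin n), h W.card * compInd W E := by
  have := Finset.single_le_sum (f := fun W : Finset (Fin n) => h W.card * compInd W E)
    (fun W _ => mul_nonneg (hh _) (compInd_nonneg W E)) (Finset.mem_univ W)
  simpa [compInd, hW] using this

lemma exists_isCompSet_card_eq_L1 (hn : 0 < n) (hE : E ⊆ allPairs n) :
    ∃ W, IsCompSet W E ∧ W.card = L1 E := by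
  have : (Finset.univ : Finset (Fin n)).Nonempty := ⟨⟨0, hn⟩, Finset.mem_univ _⟩
  obtain ⟨v, _, hv⟩ := Finset.exists_mem_eq_sup _ this fun v => compCard E v
  exact ⟨compSet E v, isCompSet_compSet hE v, (card_compSet E v).trans hv.symm⟩

lemma IsCompSet.card_le_L1 (hE : E ⊆ allPairs n) {W : Finset (Fin n)} (h : IsCompSet W E) :
    W.card ≤ L1 E := by
  obtain ⟨v, hv⟩ := h.nonempty
  rw [← h.compSet_eq hE hv, card_compSet]
  exact Finset.le_sup (f := fun v => compCard E v) (Finset.mem_univ v)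

lemma sq_L1_le (hn : 0 < n) (hE : E ⊆ allPairs n) : (L1 E : ℝ) ^ 2 ≤ (n : ℝ) ^ 2 := by
  obtain ⟨W, _, hW⟩ := exists_isCompSet_card_eq_L1 hn hE
  have : L1 E ≤ n := by
    rw [← hW]
    exact (Finset.card_le_univ _).trans (by simp)
  gcongr

end pointwise

lemma perc_largeSum (p : ℝ) (n : ℕ) :
    perc p (allPairs n) (largeSum n) =
      ∑ k ∈ range (n + 1), (if n < k * k then (k : ℝ) * k else 0) * expComps p n k :=
  perc_sum_compInd p n fun k => if n < k * k then (k : ℝ) * k else 0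

/-! ### From eventual bounds to bounds for all `n` -/

lemma exists_forall_le_of_eventually {a : ℕ → ℝ} {K : ℝ}
    (h : ∀ᶠ n in Filter.atTop, a n ≤ K) : ∃ K', 0 < K' ∧ ∀ n, a n ≤ K' := by
  obtain ⟨N, hN⟩ := Filter.eventually_atTop.1 h
  refine ⟨1 + |K| + ∑ i ∈ range N, |a i|, by positivity, fun n => ?_⟩
  have hs : 0 ≤ ∑ i ∈ range N, |a i| := Finset.sum_nonneg fun i _ => abs_nonneg _
  rcases le_or_gt N n with hn | hn
  · linarith [hN n hn, le_abs_self K]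
  · have := Finset.single_le_sum (f := fun i => |a i|) (fun i _ => abs_nonneg _)
      (Finset.mem_range.2 hn)
    linarith [le_abs_self (a n), abs_nonneg K]

lemma exists_erExp_bounds {lam C c K₁ K₂ : ℝ} (hlam : 0 < lam) (hc : 0 < c) (hC : 0 ≤ C)
    (h : SmallCompDecay lam C c) (X : ∀ n : ℕ, Finset (Fin n × Fin n) → ℝ) (hX : ∀ E, X 0 E = 0)
    (h1 : ∀ᶠ n : ℕ in Filter.atTop,
      perc (lam / n) (allPairs n) (fun E => |X n E - smallSum n (fun k => k) E|) ≤ K₁)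
    (h2 : ∀ᶠ n : ℕ in Filter.atTop,
      perc (lam / n) (allPairs n) (fun E => (X n E - smallSum n (fun k => k) E) ^ 2) ≤ K₂ * n) :
    ∃ γ K : ℝ, 0 < γ ∧ 0 < K ∧ ∀ n : ℕ,
      |erExp n (lam / n) (X n) - γ * n| ≤ K ∧
      erExp n (lam / n) (fun E => X n E ^ 2) - erExp n (lam / n) (X n) ^ 2 ≤ K * n := by
  obtain ⟨γ, K₃, hγ, h3⟩ := exists_perc_smallSum_sub_le hlam hc h
  obtain ⟨K₄, -, h4⟩ := exists_percVar_smallSum_le hlam hc hC h (g := fun k => (k : ℝ))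
    (fun k => Nat.cast_nonneg k) fun k _ => le_rfl
  have hmean : ∀ᶠ n : ℕ in Filter.atTop, |erExp n (lam / n) (X n) - γ * n| ≤ K₁ + K₃ := by
    filter_upwards [h1, h3, Filter.eventually_ge_atTop ⌈lam⌉₊, Filter.eventually_gt_atTop 0]
      with n h1 h3 hn hn0
    have hn0 : (0 : ℝ) < n := by exact_mod_cast hn0
    have hp : 0 ≤ lam / n := by positivity
    have hp1 : lam / n ≤ 1 := (div_le_one hn0).2 (Nat.ceil_le.1 hn)
    have h5 := (abs_perc_le (P := allPairs n) hp hp1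
      (fun E => X n E - smallSum n (fun k => k) E)).trans h1
    rw [perc_sub] at h5
    calc |erExp n (lam / n) (X n) - γ * n|
        = |(perc (lam / n) (allPairs n) (X n) -
              perc (lam / n) (allPairs n) (smallSum n fun k => k)) +
            (perc (lam / n) (allPairs n) (smallSum n fun k => k) - γ * n)| := by
          rw [erExp_eq_perc]; congr 1; ring
      _ ≤ _ := (abs_add_le _ _).trans (add_le_add h5 h3)
  have hvar : ∀ᶠ n : ℕ in Filter.atTop,
      (erExp n (lam / n) (fun E => X n E ^ 2) - erExp n (lam / n) (X n) ^ 2) / n ≤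
        2 * K₄ + 2 * K₂ := by
    filter_upwards [h2, h4, Filter.eventually_ge_atTop ⌈lam⌉₊, Filter.eventually_gt_atTop 0]
      with n h2 h4 hn hn0
    have hn0 : (0 : ℝ) < n := by exact_mod_cast hn0
    have hp : 0 ≤ lam / n := by positivity
    have hp1 : lam / n ≤ 1 := (div_le_one hn0).2 (Nat.ceil_le.1 hn)
    have h5 := percVar_add_le (P := allPairs n) hp hp1 (smallSum n fun k => k)
      (fun E => X n E - smallSum n (fun k => k) E)
    simp only [add_sub_cancel, percVar] at h5 h4
    simp only [erExp_eq_perc]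
    rw [div_le_iff₀ hn0]
    linarith
  obtain ⟨K, hK, hK'⟩ := exists_forall_le_of_eventually hmean
  obtain ⟨L, hL, hL'⟩ := exists_forall_le_of_eventually hvar
  refine ⟨γ, K + L, hγ, by positivity, fun n => ⟨(hK' n).trans (by linarith), ?_⟩⟩
  rcases Nat.eq_zero_or_pos n with rfl | hn
  · simp [hX, erExp]
  · have hn0 : (0 : ℝ) < n := by exact_mod_cast hn
    have := (div_le_iff₀ hn0).1 (hL' n)
    nlinarith

/-! ### The subcritical case -/

lemma exists_bounds_of_lt_one {lam : ℝ} (hlam : 0 < lam) (hlam1 : lam < 1) :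
    ∃ γ K : ℝ, 0 < γ ∧ 0 < K ∧ ∀ n : ℕ,
      |erExp n (lam / n) (fun E => (sumCompSq E : ℝ)) - γ * n| ≤ K ∧
      erExp n (lam / n) (fun E => ((sumCompSq E : ℝ)) ^ 2) -
          erExp n (lam / n) (fun E => (sumCompSq E : ℝ)) ^ 2 ≤ K * n := by
  set c := (1 - lam) ^ 2 / 16 with hc
  have hε : 0 < 1 - lam := by linarith
  have hc0 : 0 < c := by positivity
  have hdecay : ∀ᶠ n : ℕ in Filter.atTop, ∀ k : ℕ,
      k * expComps (lam / n) n k ≤ lam⁻¹ * n * Real.exp (-c * k) := by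
    filter_upwards [Filter.eventually_ge_atTop ⌈8 * lam / (1 - lam)⌉₊,
      Filter.eventually_gt_atTop 0] with n hn hn0 k
    have hn0 : (0 : ℝ) < n := by exact_mod_cast hn0
    have hn : 8 * lam / (1 - lam) ≤ n := Nat.ceil_le.1 hn
    rw [div_le_iff₀ hε] at hn
    have hp : lam / n ≤ (1 - lam) / 8 := by rw [div_le_iff₀ hn0]; linarith
    have := expComps_le_of_subcritical hε (by linarith) (div_pos hlam hn0) hp (n := n)
      (le_of_eq (by field_simp; ring)) k
    rwa [inv_div, div_eq_inv_mul (n : ℝ) lam] at this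
  obtain ⟨K, hK, hKn⟩ := exists_pow_mul_sum_exp_le hc0 4
  have hlarge : ∀ᶠ n : ℕ in Filter.atTop, 1 ≤ (n : ℝ) ∧ lam / n ≤ 1 ∧
      (n : ℝ) ^ 2 * perc (lam / n) (allPairs n) (largeSum n) ≤ lam⁻¹ * K := by
    filter_upwards [hdecay, Filter.eventually_ge_atTop 1] with n hn hn1
    have hn1 : (1 : ℝ) ≤ n := by exact_mod_cast hn1
    refine ⟨hn1, (div_le_one (by linarith)).2 (by linarith), ?_⟩
    have h1 : perc (lam / n) (allPairs n) (largeSum n) ≤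
        lam⁻¹ * n ^ 2 * ∑ k ∈ (range (n + 1)).filter (fun k => n < k * k), Real.exp (-c * k) := by
      rw [perc_largeSum, Finset.mul_sum, Finset.sum_filter]
      refine Finset.sum_le_sum fun k hk => ?_
      split_ifs
      · have hkn : (k : ℝ) ≤ n := by exact_mod_cast Nat.lt_succ_iff.1 (Finset.mem_range.1 hk)
        calc (k : ℝ) * k * expComps (lam / n) n k = k * (k * expComps (lam / n) n k) := by ring
          _ ≤ n * (lam⁻¹ * n * Real.exp (-c * k)) :=
            mul_le_mul hkn (hn k) (by
              refine mul_nonneg (Nat.cast_nonneg k) (expComps_nonneg (by positivity) ?_ n k)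
              exact (div_le_one (by linarith)).2 (by linarith)) (by positivity)
          _ = _ := by ring
      · simp
    have h2 := hKn n ((range (n + 1)).filter fun k => n < k * k)
      fun k hk => (Finset.mem_filter.1 hk).2
    calc _ ≤ (n : ℝ) ^ 2 * (lam⁻¹ * n ^ 2 *
          ∑ k ∈ (range (n + 1)).filter (fun k => n < k * k), Real.exp (-c * k)) := by gcongr
      _ = lam⁻¹ * ((n : ℝ) ^ 4 *
          ∑ k ∈ (range (n + 1)).filter (fun k => n < k * k), Real.exp (-c * k)) := by ring
      _ ≤ _ := by gcongr
  have hdiff : ∀ n : ℕ, ∀ E ⊆ allPairs n,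
      (sumCompSq E : ℝ) - smallSum n (fun k => k) E = largeSum n E := fun n E hE => by
    rw [sumCompSq_eq_add hE]; ring
  have hKl : 0 ≤ lam⁻¹ * K := by positivity
  refine exists_erExp_bounds hlam hc0 (inv_nonneg.2 hlam.le) (K₁ := lam⁻¹ * K) (K₂ := lam⁻¹ * K)
    (hdecay.mono fun n hn k _ => hn k) (fun n E => (sumCompSq E : ℝ)) (fun E => by simp [sumCompSq])
    ?_ ?_
  · filter_upwards [hlarge] with n hn
    have hp : 0 ≤ lam / n := by positivity
    rw [perc_congr (g := largeSum n) fun E hE => by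
      rw [hdiff n E hE, abs_of_nonneg largeSum_nonneg]]
    have := perc_nonneg (P := allPairs n) hp hn.2.1 (f := largeSum n) fun E _ => largeSum_nonneg
    have h1 : (1 : ℝ) ≤ (n : ℝ) ^ 2 := one_le_pow₀ hn.1
    exact (le_mul_of_one_le_left this h1).trans hn.2.2
  · filter_upwards [hlarge] with n hn
    have hp : 0 ≤ lam / n := by positivity
    calc _ ≤ perc (lam / n) (allPairs n) (fun E => (n : ℝ) ^ 2 * largeSum n E) := by
          refine perc_mono hp hn.2.1 fun E hE => ?_
          rw [hdiff n E hE, sq]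
          exact mul_le_mul_of_nonneg_right (largeSum_le hE) largeSum_nonneg
      _ ≤ lam⁻¹ * K := by rw [perc_const_mul]; exact hn.2.2
      _ ≤ _ := by nlinarith [hn.1]

/-! ### The supercritical case -/

section pointwise
variable {n : ℕ} {E : Finset (Fin n × Fin n)}

/-- The indicator of the event that every component has at most `√n` vertices. -/
noncomputable def allSmall (n : ℕ) (E : Finset (Fin n × Fin n)) : ℝ :=
  if ∀ W, IsCompSet W E → W.card * W.card ≤ n then 1 else 0

/-- The number of components with more than `√n` and at most `κ n` vertices. -/
noncomputable def midCount (κ : ℝ) (n : ℕ) (E : Finset (Fin n × Fin n)) : ℝ :=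
  ∑ W : Finset (Fin n),
    (if n < W.card * W.card ∧ (W.card : ℝ) ≤ κ * n then 1 else 0) * compInd W E

/-- The number of ordered pairs of distinct components with more than `κ n` vertices each. -/
noncomputable def giantPairs (κ : ℝ) (n : ℕ) (E : Finset (Fin n × Fin n)) : ℝ :=
  ∑ W : Finset (Fin n), ∑ W' ∈ Wᶜ.powerset,
    ((if κ * n < W.card then 1 else 0) * (if κ * n < W'.card then 1 else 0)) *
      (compInd W E * compInd W' E)

lemma allSmall_nonneg : 0 ≤ allSmall n E := by
  unfold allSmall; split_ifs <;> norm_num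

lemma allSmall_eq_one (h : ∀ W, IsCompSet W E → W.card * W.card ≤ n) : allSmall n E = 1 :=
  if_pos h

lemma allSmall_eq_zero (h : ¬ ∀ W, IsCompSet W E → W.card * W.card ≤ n) : allSmall n E = 0 :=
  if_neg h

lemma midCount_nonneg {κ : ℝ} : 0 ≤ midCount κ n E :=
  Finset.sum_nonneg fun W _ => mul_nonneg (by split_ifs <;> norm_num) (compInd_nonneg W E)

lemma giantPairs_term_nonneg {κ : ℝ} (W W' : Finset (Fin n)) :
    0 ≤ ((if κ * n < W.card then 1 else 0) * (if κ * n < W'.card then 1 else 0)) *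
      (compInd W E * compInd W' E) :=
  mul_nonneg (mul_nonneg (by split_ifs <;> norm_num) (by split_ifs <;> norm_num))
    (mul_nonneg (compInd_nonneg W E) (compInd_nonneg W' E))

lemma giantPairs_nonneg {κ : ℝ} : 0 ≤ giantPairs κ n E :=
  Finset.sum_nonneg fun W _ => Finset.sum_nonneg fun W' _ => giantPairs_term_nonneg W W'

lemma one_le_midCount {κ : ℝ} {W : Finset (Fin n)} (hW : IsCompSet W E)
    (h : n < W.card * W.card) (hκ : (W.card : ℝ) ≤ κ * n) : 1 ≤ midCount κ n E := by
  have := le_sum_mul_compInd (h := fun k => if n < k * k ∧ (k : ℝ) ≤ κ * n then 1 else 0)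
    (fun k => by split_ifs <;> norm_num) hW
  simpa [h, hκ, midCount] using this

lemma one_le_giantPairs {κ : ℝ} (hE : E ⊆ allPairs n) {W W' : Finset (Fin n)}
    (hW : IsCompSet W E) (hW' : IsCompSet W' E) (hne : W ≠ W') (h : κ * n < W.card)
    (h' : κ * n < W'.card) : 1 ≤ giantPairs κ n E := by
  have hmem : W' ∈ Wᶜ.powerset := by
    rw [Finset.mem_powerset, Finset.subset_compl_iff_disjoint_left]
    exact hW.disjoint hE hW' hne
  have h1 := Finset.single_le_sum
    (f := fun W' : Finset (Fin n) =>
      ((if κ * n < W.card then 1 else 0) * (if κ * n < W'.card then 1 else 0)) *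
        (compInd W E * compInd W' E)) (fun W' _ => giantPairs_term_nonneg W W') hmem
  have h2 := Finset.single_le_sum
    (f := fun W : Finset (Fin n) => ∑ W' ∈ Wᶜ.powerset,
      ((if κ * n < W.card then 1 else 0) * (if κ * n < W'.card then 1 else 0)) *
        (compInd W E * compInd W' E))
    (fun W _ => Finset.sum_nonneg fun W' _ => giantPairs_term_nonneg W W') (Finset.mem_univ W)
  refine le_trans (le_of_eq ?_) (h1.trans h2)
  simp [h, h', compInd, hW, hW']

lemma largeSum_eq_zero (h : ∀ W, IsCompSet W E → W.card * W.card ≤ n) : largeSum n E = 0 := by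
  refine Finset.sum_eq_zero fun W _ => ?_
  by_cases hW : IsCompSet W E
  · simp [h W hW]
  · simp [compInd, hW]

lemma largeSum_eq_sq_L1 (hn : 0 < n) (hE : E ⊆ allPairs n) {W : Finset (Fin n)}
    (hW : IsCompSet W E) (h : n < W.card * W.card)
    (huniq : ∀ W', IsCompSet W' E → n < W'.card * W'.card → W' = W) :
    largeSum n E = (L1 E : ℝ) ^ 2 := by
  obtain ⟨W₁, hW₁, hc⟩ := exists_isCompSet_card_eq_L1 hn hE
  have hle := hW.card_le_L1 hE
  have hW₁ : W₁ = W := by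
    refine huniq W₁ hW₁ ?_
    rw [hc]
    exact h.trans_le (Nat.mul_le_mul hle hle)
  rw [← hc, hW₁, largeSum, Finset.sum_eq_single W]
  · simp [compInd, hW, h, sq]
  · intro W' _ hne
    by_cases hW' : IsCompSet W' E
    · have : ¬ n < W'.card * W'.card := fun hlt => hne (huniq W' hW' hlt)
      simp [this]
    · simp [compInd, hW']
  · simp

lemma largeSum_sub_sq_L1_cases (κ : ℝ) (hn : 0 < n) (hE : E ⊆ allPairs n) :
    largeSum n E - (L1 E : ℝ) ^ 2 = 0 ∨
      (allSmall n E = 1 ∧ largeSum n E - (L1 E : ℝ) ^ 2 = -(L1 E : ℝ) ^ 2) ∨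
      1 ≤ midCount κ n E + giantPairs κ n E := by
  by_cases hA : ∀ W, IsCompSet W E → W.card * W.card ≤ n
  · right; left
    simp [allSmall_eq_one hA, largeSum_eq_zero hA]
  push Not at hA
  obtain ⟨W, hW, h⟩ := hA
  have hm := midCount_nonneg (n := n) (E := E) (κ := κ)
  have hg := giantPairs_nonneg (n := n) (E := E) (κ := κ)
  by_cases huniq : ∀ W', IsCompSet W' E → n < W'.card * W'.card → W' = W
  · left
    rw [largeSum_eq_sq_L1 hn hE hW h huniq, sub_self]
  right; right
  push Not at huniq
  obtain ⟨W', hW', h', hne⟩ := huniq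
  rcases le_or_gt (W.card : ℝ) (κ * n) with hk | hk
  · linarith [one_le_midCount hW h hk]
  rcases le_or_gt (W'.card : ℝ) (κ * n) with hk' | hk'
  · linarith [one_le_midCount hW' h' hk']
  · linarith [one_le_giantPairs hE hW' hW hne hk' hk]

lemma abs_largeSum_sub_sq_L1_le (hn : 0 < n) (hE : E ⊆ allPairs n) :
    |largeSum n E - (L1 E : ℝ) ^ 2| ≤ (n : ℝ) ^ 2 := by
  have h1 := sq_L1_le hn hE
  have h2 := largeSum_le hE
  have h3 := largeSum_nonneg (n := n) (E := E)
  rw [abs_le]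
  constructor <;> nlinarith [sq_nonneg (L1 E : ℝ)]

lemma pow_L1_mul_allSmall_le (hn : 0 < n) (hE : E ⊆ allPairs n) :
    (L1 E : ℝ) ^ 4 * allSmall n E ≤
      ∑ W : Finset (Fin n), sqrtTrunc n (fun k => (k : ℝ) ^ (3 + 1)) W.card * compInd W E := by
  have hnn : ∀ k : ℕ, 0 ≤ sqrtTrunc n (fun k => (k : ℝ) ^ (3 + 1)) k := fun k => by
    unfold sqrtTrunc; split_ifs <;> positivity
  by_cases hA : ∀ W, IsCompSet W E → W.card * W.card ≤ n
  · obtain ⟨W, hW, hc⟩ := exists_isCompSet_card_eq_L1 hn hE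
    have := le_sum_mul_compInd hnn hW
    refine le_trans (le_of_eq ?_) this
    rw [allSmall_eq_one hA, mul_one, ← hc, sqrtTrunc, if_pos (hA W hW)]
  · rw [allSmall_eq_zero hA, mul_zero]
    exact Finset.sum_nonneg fun W _ => mul_nonneg (hnn _) (compInd_nonneg W E)

lemma sq_largeSum_sub_sq_L1_le (κ : ℝ) (hn : 0 < n) (hE : E ⊆ allPairs n) :
    (largeSum n E - (L1 E : ℝ) ^ 2) ^ 2 ≤
      ∑ W : Finset (Fin n), sqrtTrunc n (fun k => (k : ℝ) ^ (3 + 1)) W.card * compInd W E +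
        (n : ℝ) ^ 4 * (midCount κ n E + giantPairs κ n E) := by
  have h1 := pow_L1_mul_allSmall_le hn hE
  have hm := midCount_nonneg (n := n) (E := E) (κ := κ)
  have hg := giantPairs_nonneg (n := n) (E := E) (κ := κ)
  have hB : 0 ≤ (n : ℝ) ^ 4 * (midCount κ n E + giantPairs κ n E) := by positivity
  have hA : 0 ≤ (L1 E : ℝ) ^ 4 * allSmall n E := mul_nonneg (by positivity) allSmall_nonneg
  rcases largeSum_sub_sq_L1_cases κ hn hE with h | ⟨ha, h⟩ | h
  · rw [h]; linarith
  · rw [ha, mul_one] at h1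
    rw [h]
    linarith [show (-(L1 E : ℝ) ^ 2) ^ 2 = (L1 E : ℝ) ^ 4 by ring]
  · have h2 := pow_le_pow_left₀ (abs_nonneg _) (abs_largeSum_sub_sq_L1_le hn hE) 2
    rw [sq_abs] at h2
    have h3 := mul_le_mul_of_nonneg_left h (show (0 : ℝ) ≤ (n : ℝ) ^ 4 by positivity)
    linarith [show ((n : ℝ) ^ 2) ^ 2 = (n : ℝ) ^ 4 by ring]

lemma abs_largeSum_sub_sq_L1_le_add (κ : ℝ) (hn : 0 < n) (hE : E ⊆ allPairs n) :
    |largeSum n E - (L1 E : ℝ) ^ 2| ≤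
      (n : ℝ)⁻¹ * (∑ W : Finset (Fin n),
          sqrtTrunc n (fun k => (k : ℝ) ^ (3 + 1)) W.card * compInd W E) +
        n * allSmall n E + (n : ℝ) ^ 4 * (midCount κ n E + giantPairs κ n E) := by
  have h1 := pow_L1_mul_allSmall_le hn hE
  have hm := midCount_nonneg (n := n) (E := E) (κ := κ)
  have hg := giantPairs_nonneg (n := n) (E := E) (κ := κ)
  have hs := allSmall_nonneg (n := n) (E := E)
  have hn1 : (1 : ℝ) ≤ n := by exact_mod_cast hn
  have hB : 0 ≤ (n : ℝ) ^ 4 * (midCount κ n E + giantPairs κ n E) := by positivity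
  have hA : 0 ≤ (L1 E : ℝ) ^ 4 * allSmall n E := mul_nonneg (by positivity) hs
  set T := ∑ W : Finset (Fin n), sqrtTrunc n (fun k => (k : ℝ) ^ (3 + 1)) W.card * compInd W E
  have hT : 0 ≤ (n : ℝ)⁻¹ * T := mul_nonneg (by positivity) (hA.trans h1)
  have hS : 0 ≤ n * allSmall n E := by positivity
  rcases largeSum_sub_sq_L1_cases κ hn hE with h | ⟨ha, h⟩ | h
  · rw [h, abs_zero]; linarith
  · rw [ha, mul_one] at h1
    rw [h, abs_neg, abs_of_nonneg (by positivity), ha]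
    have h2 : (L1 E : ℝ) ^ 2 ≤ (n : ℝ)⁻¹ * (L1 E : ℝ) ^ 4 + n := by
      have h3 : 2 * (n * (L1 E : ℝ) ^ 2) ≤ (L1 E : ℝ) ^ 4 + n ^ 2 := by
        nlinarith [sq_nonneg ((L1 E : ℝ) ^ 2 - n)]
      have h4 := mul_le_mul_of_nonneg_left h3 (show (0 : ℝ) ≤ (n : ℝ)⁻¹ by positivity)
      have h5 : (n : ℝ)⁻¹ * (2 * (n * (L1 E : ℝ) ^ 2)) = 2 * (L1 E : ℝ) ^ 2 := by field_simp
      have h6 : (n : ℝ)⁻¹ * ((L1 E : ℝ) ^ 4 + n ^ 2) = (n : ℝ)⁻¹ * (L1 E : ℝ) ^ 4 + n := by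
        field_simp
      nlinarith [sq_nonneg (L1 E : ℝ)]
    have h3 := mul_le_mul_of_nonneg_left h1 (show (0 : ℝ) ≤ (n : ℝ)⁻¹ by positivity)
    linarith
  · have h2 := abs_largeSum_sub_sq_L1_le hn hE
    have h3 := mul_le_mul_of_nonneg_left h (show (0 : ℝ) ≤ (n : ℝ) ^ 4 by positivity)
    have h4 : (n : ℝ) ^ 2 ≤ (n : ℝ) ^ 4 := pow_le_pow_right₀ hn1 (by norm_num)
    linarith

lemma smallSum_one_eq (hE : E ⊆ allPairs n)
    (h : ∀ W, IsCompSet W E → W.card * W.card ≤ n) : smallSum n (fun _ => 1) E = n := by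
  rw [← sum_card_mul_compInd hE]
  refine Finset.sum_congr rfl fun W _ => ?_
  by_cases hW : IsCompSet W E
  · simp [sqrtTrunc, h W hW]
  · simp [compInd, hW]

end pointwise

lemma perc_midCount (κ p : ℝ) (n : ℕ) :
    perc p (allPairs n) (midCount κ n) =
      ∑ k ∈ (range (n + 1)).filter (fun k => n < k * k ∧ (k : ℝ) ≤ κ * n), expComps p n k := by
  rw [Finset.sum_filter]
  refine (perc_sum_compInd p n
    fun k => if n < k * k ∧ (k : ℝ) ≤ κ * n then 1 else 0).trans
      (Finset.sum_congr rfl fun k _ => ?_)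
  split_ifs <;> simp

lemma perc_giantPairs_le {κ p B : ℝ} (hκ : 0 ≤ κ) (hκ1 : κ ≤ 1) (hp : 0 ≤ p) (hp1 : p ≤ 1) {n : ℕ}
    (hB : ∀ m ≤ n, (m : ℝ) ≤ (1 - κ) * n →
      ∑ l ∈ (range (n + 1)).filter (fun l => κ * n < (l : ℕ)), expComps p m l ≤ B) :
    perc p (allPairs n) (giantPairs κ n) ≤ n * B := by
  set s := (range (n + 1)).filter fun l : ℕ => κ * n < l with hs
  have hW : ∀ W : Finset (Fin n), κ * n < W.card →
      ∑ W' ∈ Wᶜ.powerset, ((if κ * n < W.card then 1 else 0) *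
        (if κ * n < W'.card then 1 else 0)) *
        perc p (allPairs n) (fun E => compInd W E * compInd W' E) ≤
      perc p (allPairs n) (compInd W) * B := by
    intro W hW
    have hcard : W.card ≤ n := (Finset.card_le_univ _).trans (by simp)
    have hP0 : 0 ≤ perc p (allPairs n) (compInd W) :=
      perc_nonneg hp hp1 fun E _ => compInd_nonneg W E
    have e1 : ∀ W' ∈ Wᶜ.powerset, ((if κ * n < W.card then 1 else 0) *
        (if κ * n < W'.card then 1 else 0)) *
        perc p (allPairs n) (fun E => compInd W E * compInd W' E) =
        perc p (allPairs n) (compInd W) * (fun l : ℕ => if κ * n < (l : ℝ) then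
          connProb p l * (1 - p) ^ (l * (n - W.card - l)) else 0) W'.card := by
      intro W' hW'
      have hd : Disjoint W W' :=
        Finset.subset_compl_iff_disjoint_left.1 (Finset.mem_powerset.1 hW')
      rw [perc_compInd_mul p hd, show perc p (allPairs n) (compInd W) = _ from perc_compInd p W]
      simp only [hW, if_true, one_mul]
      split_ifs
      · rw [pow_add]; ring
      · simp
    rw [Finset.sum_congr rfl e1, ← Finset.mul_sum, Finset.sum_powerset_apply_card
      fun l : ℕ => if κ * n < (l : ℝ) then
        connProb p l * (1 - p) ^ (l * (n - W.card - l)) else 0,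
      Finset.card_compl, Fintype.card_fin]
    refine mul_le_mul_of_nonneg_left ?_ hP0
    have hm : ((n - W.card : ℕ) : ℝ) ≤ (1 - κ) * n := by
      rw [Nat.cast_sub hcard]; linarith
    refine le_trans ?_ (hB (n - W.card) (Nat.sub_le _ _) hm)
    rw [hs, Finset.sum_filter]
    refine le_trans (Finset.sum_le_sum_of_subset_of_nonneg (t := range (n + 1)) ?_ ?_)
      (Finset.sum_le_sum fun l _ => le_of_eq ?_)
    · exact Finset.range_mono (by omega)
    · intro l _ _
      have := connProb_nonneg hp hp1 l
      have : 0 ≤ 1 - p := by linarith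
      split_ifs
      · positivity
      · simp
    · split_ifs
      · rw [expComps, nsmul_eq_mul]
      · simp
  have hB0 : 0 ≤ B := by
    refine le_trans (Finset.sum_nonneg fun l _ => expComps_nonneg hp hp1 0 l)
      (hB 0 (Nat.zero_le _) ?_)
    have : 0 ≤ 1 - κ := by linarith
    push_cast
    positivity
  have hE : perc p (allPairs n) (giantPairs κ n) =
      ∑ W : Finset (Fin n), ∑ W' ∈ Wᶜ.powerset, ((if κ * n < W.card then 1 else 0) *
        (if κ * n < W'.card then 1 else 0)) *
        perc p (allPairs n) (fun E => compInd W E * compInd W' E) := by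
    unfold giantPairs
    simp only [perc_sum, perc_const_mul]
  rw [hE]
  calc _ ≤ ∑ W : Finset (Fin n), (W.card : ℝ) * perc p (allPairs n) (compInd W) * B := by
        refine Finset.sum_le_sum fun W _ => ?_
        have hP0 : 0 ≤ perc p (allPairs n) (compInd W) :=
          perc_nonneg hp hp1 fun E _ => compInd_nonneg W E
        by_cases h : κ * n < W.card
        · refine (hW W h).trans (mul_le_mul_of_nonneg_right ?_ hB0)
          refine le_mul_of_one_le_left hP0 ?_
          have : 0 < (W.card : ℝ) := lt_of_le_of_lt (by positivity) h
          exact_mod_cast this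
        · simp only [h, if_false, zero_mul, Finset.sum_const_zero]
          positivity
    _ = n * B := by
        rw [← Finset.sum_mul]
        congr 1
        simp only [← perc_const_mul]
        rw [← perc_sum, perc_congr (g := fun _ => (n : ℝ)) fun E hE => sum_card_mul_compInd hE,
          perc_const]

lemma perc_allSmall_le {lam K δ : ℝ} (hδ : 0 < δ) {n : ℕ} (hn : 0 < n) (hp : 0 ≤ lam / n)
    (hp1 : lam / n ≤ 1)
    (hmean : perc (lam / n) (allPairs n) (smallSum n fun _ => 1) ≤ (1 - δ) * n)
    (hvar : percVar (lam / n) (allPairs n) (smallSum n fun _ => 1) ≤ K * n) :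
    n * perc (lam / n) (allPairs n) (allSmall n) ≤ K / δ ^ 2 := by
  have hn0 : (0 : ℝ) < n := by exact_mod_cast hn
  have h1 : (δ * n) ^ 2 * perc (lam / n) (allPairs n) (allSmall n) ≤ K * n := by
    rw [← perc_const_mul]
    refine le_trans ?_ hvar
    rw [percVar_eq]
    refine perc_mono hp hp1 fun E hE => ?_
    by_cases hA : ∀ W, IsCompSet W E → W.card * W.card ≤ n
    · rw [smallSum_one_eq hE hA, allSmall_eq_one hA, mul_one]
      have : δ * n ≤ n - perc (lam / n) (allPairs n) (smallSum n fun _ => 1) := by linarith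
      exact pow_le_pow_left₀ (by positivity) this 2
    · rw [allSmall_eq_zero hA, mul_zero]
      positivity
  rw [le_div_iff₀ (by positivity)]
  refine le_of_mul_le_mul_right ?_ hn0
  linarith

lemma eventually_le_mul_of_mul_self_le {κ : ℝ} (hκ : 0 < κ) :
    ∀ᶠ n : ℕ in Filter.atTop, ∀ k : ℕ, k * k ≤ n → (k : ℝ) ≤ κ * n := by
  filter_upwards [Filter.eventually_ge_atTop ⌈1 / κ ^ 2⌉₊] with n hn k hk
  have hn : 1 / κ ^ 2 ≤ n := Nat.ceil_le.1 hn
  rw [div_le_iff₀ (by positivity)] at hn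
  have hk : (k : ℝ) * k ≤ n := by exact_mod_cast hk
  refine le_of_sq_le_sq ?_ (by positivity)
  nlinarith [Nat.cast_nonneg (α := ℝ) n]

lemma smallCompDecay_of_le {lam κ c : ℝ} (hlam : 0 < lam) (hκ : 0 < κ)
    (h : ∀ᶠ n : ℕ in Filter.atTop, ∃ m ≤ n, ∀ k : ℕ, (k : ℝ) ≤ κ * n →
      expComps (lam / n) n k ≤ Real.exp (-c * k) * expComps (lam / n) m k) :
    SmallCompDecay lam 1 c ∧ ∀ᶠ n : ℕ in Filter.atTop, ∀ k : ℕ, (k : ℝ) ≤ κ * n →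
      k * expComps (lam / n) n k ≤ n * Real.exp (-c * k) := by
  have key : ∀ᶠ n : ℕ in Filter.atTop, ∀ k : ℕ, (k : ℝ) ≤ κ * n →
      k * expComps (lam / n) n k ≤ n * Real.exp (-c * k) := by
    filter_upwards [h, Filter.eventually_ge_atTop ⌈lam⌉₊, Filter.eventually_gt_atTop 0]
      with n ⟨m, hmn, hm⟩ hn hn0 k hk
    have hn0 : (0 : ℝ) < n := by exact_mod_cast hn0
    have hp : 0 ≤ lam / n := by positivity
    have hp1 : lam / n ≤ 1 := (div_le_one hn0).2 (Nat.ceil_le.1 hn)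
    have hmn : (m : ℝ) ≤ n := by exact_mod_cast hmn
    have h1 := mul_le_mul_of_nonneg_left (hm k hk) (Nat.cast_nonneg (α := ℝ) k)
    have h2 := mul_le_mul_of_nonneg_left ((mul_expComps_le hp hp1 m k).trans hmn)
      (Real.exp_pos (-c * k)).le
    linarith
  refine ⟨?_, key⟩
  filter_upwards [key, eventually_le_mul_of_mul_self_le hκ] with n h1 h2 k hk
  rw [one_mul]
  exact h1 k (h2 k hk)

lemma perc_smallSum_one_le {p κ c : ℝ} (hp : 0 ≤ p) (hp1 : p ≤ 1) (hc : 0 < c) {n m : ℕ}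
    (hmn : m ≤ n) (hκ : ∀ k : ℕ, k * k ≤ n → (k : ℝ) ≤ κ * n)
    (h : ∀ k : ℕ, (k : ℝ) ≤ κ * n → expComps p n k ≤ Real.exp (-c * k) * expComps p m k) :
    perc p (allPairs n) (smallSum n fun _ => 1) ≤ Real.exp (-c) * n := by
  have hm : ∑ k ∈ range (n + 1), (k : ℝ) * expComps p m k = m := by
    rw [← sum_mul_expComps p m]
    symm
    refine Finset.sum_subset (Finset.range_mono (by omega)) fun k _ hk => ?_
    rw [expComps_eq_zero p (by simpa using hk), mul_zero]
  rw [perc_smallSum]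
  calc _ ≤ ∑ k ∈ range (n + 1), Real.exp (-c) * (k * expComps p m k) := by
        refine Finset.sum_le_sum fun k _ => ?_
        have hnn := expComps_nonneg hp hp1 m k
        unfold sqrtTrunc
        split_ifs with hk
        · rcases Nat.eq_zero_or_pos k with rfl | hk0
          · simp
          have hk1 : (1 : ℝ) ≤ k := by exact_mod_cast hk0
          calc (k : ℝ) * 1 * expComps p n k
              ≤ k * 1 * (Real.exp (-c * k) * expComps p m k) := by
                gcongr
                exact h k (hκ k hk)
            _ ≤ k * 1 * (Real.exp (-c) * expComps p m k) := by
                gcongr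
                nlinarith
            _ = _ := by ring
        · rw [mul_zero, zero_mul]
          positivity
    _ = Real.exp (-c) * m := by rw [← Finset.mul_sum, hm]
    _ ≤ _ := by gcongr

lemma exists_perc_giantPairs_le {lam κ : ℝ} (hlam : 1 < lam) (hκ : 1 - 1 / lam < κ)
    (hκ1 : κ < 1) : ∃ K : ℝ, ∀ᶠ n : ℕ in Filter.atTop,
      (n : ℝ) ^ 4 * perc (lam / n) (allPairs n) (giantPairs κ n) ≤ K := by
  have hlam0 : 0 < lam := by linarith
  have hκ0 : 0 < κ := by
    have : 1 / lam < 1 := (div_lt_one hlam0).2 hlam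
    linarith
  set ε := 1 - lam * (1 - κ) with hε
  have hε0 : 0 < ε := by
    have : lam * (1 - κ) < lam * (1 / lam) := by gcongr; linarith
    rw [mul_one_div_cancel hlam0.ne'] at this
    linarith
  have hε1 : ε < 1 := by
    have : 0 < lam * (1 - κ) := mul_pos hlam0 (by linarith)
    linarith
  have hc : 0 < ε ^ 2 / 16 := by positivity
  obtain ⟨K, hK, hKn⟩ := exists_pow_mul_sum_exp_le hc 6
  refine ⟨lam⁻¹ * K, ?_⟩
  filter_upwards [Filter.eventually_ge_atTop ⌈8 * lam / ε⌉₊, Filter.eventually_gt_atTop 0,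
    eventually_le_mul_of_mul_self_le hκ0] with n hn hn0 hsq
  have hn0 : (0 : ℝ) < n := by exact_mod_cast hn0
  have hn : 8 * lam / ε ≤ n := Nat.ceil_le.1 hn
  rw [div_le_iff₀ hε0] at hn
  have hp : 0 < lam / n := by positivity
  have hpε : lam / n ≤ ε / 8 := by rw [div_le_iff₀ hn0]; linarith
  have hp1 : lam / n ≤ 1 := by linarith
  set s := (range (n + 1)).filter fun l : ℕ => κ * n < l with hs
  have h1 := perc_giantPairs_le (B := lam⁻¹ * n * ∑ l ∈ s, Real.exp (-(ε ^ 2 / 16) * l))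
    hκ0.le hκ1.le hp.le hp1 (n := n) fun m _ hm => by
      rw [Finset.mul_sum]
      refine Finset.sum_le_sum fun l _ => (expComps_le_mul_expComps hp.le hp1 m l).trans ?_
      refine (expComps_le_of_subcritical hε0 hε1 hp hpε ?_ l).trans (le_of_eq ?_)
      · calc (m : ℝ) * (lam / n) ≤ (1 - κ) * n * (lam / n) := by gcongr
          _ = 1 - ε := by rw [hε]; field_simp; ring
      · rw [inv_div, div_eq_inv_mul (n : ℝ) lam]
  have h2 := hKn n s fun l hl => by
    by_contra hcon
    have := hsq l (not_lt.1 hcon)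
    linarith [(Finset.mem_filter.1 hl).2]
  calc _ ≤ (n : ℝ) ^ 4 * (n * (lam⁻¹ * n * ∑ l ∈ s, Real.exp (-(ε ^ 2 / 16) * l))) := by gcongr
    _ = lam⁻¹ * ((n : ℝ) ^ 6 * ∑ l ∈ s, Real.exp (-(ε ^ 2 / 16) * l)) := by ring
    _ ≤ _ := by gcongr

lemma exists_perc_midCount_le {lam κ c : ℝ} (hlam : 0 < lam) (hc : 0 < c)
    (h : ∀ᶠ n : ℕ in Filter.atTop, ∀ k : ℕ, (k : ℝ) ≤ κ * n →
      k * expComps (lam / n) n k ≤ n * Real.exp (-c * k)) :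
    ∃ K : ℝ, ∀ᶠ n : ℕ in Filter.atTop,
      (n : ℝ) ^ 4 * perc (lam / n) (allPairs n) (midCount κ n) ≤ K := by
  obtain ⟨K, hK, hKn⟩ := exists_pow_mul_sum_exp_le hc 5
  refine ⟨K, ?_⟩
  filter_upwards [h, Filter.eventually_ge_atTop ⌈lam⌉₊, Filter.eventually_gt_atTop 0]
    with n h hn hn0
  have hn0 : (0 : ℝ) < n := by exact_mod_cast hn0
  have hp1 : lam / n ≤ 1 := (div_le_one hn0).2 (Nat.ceil_le.1 hn)
  rw [perc_midCount]
  set s := (range (n + 1)).filter fun k : ℕ => n < k * k ∧ (k : ℝ) ≤ κ * n with hs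
  have h1 : ∑ k ∈ s, expComps (lam / n) n k ≤ n * ∑ k ∈ s, Real.exp (-c * k) := by
    rw [Finset.mul_sum]
    exact Finset.sum_le_sum fun k hk =>
      (expComps_le_mul_expComps (by positivity) hp1 n k).trans
        (h k (Finset.mem_filter.1 hk).2.2)
  calc _ ≤ (n : ℝ) ^ 4 * (n * ∑ k ∈ s, Real.exp (-c * k)) := by gcongr
    _ = (n : ℝ) ^ 5 * ∑ k ∈ s, Real.exp (-c * k) := by ring
    _ ≤ K := hKn n s fun k hk => (Finset.mem_filter.1 hk).2.1

lemma exists_bounds_of_one_lt {lam : ℝ} (hlam : 1 < lam) :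
    ∃ γ K : ℝ, 0 < γ ∧ 0 < K ∧ ∀ n : ℕ,
      |erExp n (lam / n) (fun E => (sumCompSq E : ℝ) - (L1 E : ℝ) ^ 2) - γ * n| ≤ K ∧
      erExp n (lam / n) (fun E => ((sumCompSq E : ℝ) - (L1 E : ℝ) ^ 2) ^ 2) -
          erExp n (lam / n) (fun E => (sumCompSq E : ℝ) - (L1 E : ℝ) ^ 2) ^ 2 ≤ K * n := by
  have hlam0 : 0 < lam := by linarith
  obtain ⟨κ, c, hκ, hκ1, hc, hdom⟩ := exists_expComps_le_of_supercritical hlam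
  have hκ0 : 0 < κ := by
    have : 1 / lam < 1 := (div_lt_one hlam0).2 hlam
    linarith
  obtain ⟨hdecay, hmid⟩ := smallCompDecay_of_le hlam0 hκ0 hdom
  obtain ⟨K₁, h1⟩ := exists_perc_midCount_le hlam0 hc hmid
  obtain ⟨K₂, h2⟩ := exists_perc_giantPairs_le hlam hκ hκ1
  obtain ⟨K₃, -, h3⟩ := exists_percVar_smallSum_le hlam0 hc zero_le_one hdecay (g := fun _ => 1)
    (fun _ => zero_le_one) fun k hk => by exact_mod_cast hk
  obtain ⟨K₄, hK₄, h4⟩ := exists_sum_pow_mul_expComps_le hc zero_le_one hdecay 3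
  set δ := 1 - Real.exp (-c) with hδ
  have hδ0 : 0 < δ := by
    have := Real.exp_lt_one_iff.2 (show -c < 0 by linarith)
    linarith
  have hsum : ∀ (p : ℝ) (n : ℕ), perc p (allPairs n) (fun E => ∑ W : Finset (Fin n),
      sqrtTrunc n (fun k => (k : ℝ) ^ (3 + 1)) W.card * compInd W E) =
      ∑ k ∈ range (n + 1), sqrtTrunc n (fun k => (k : ℝ) ^ (3 + 1)) k * expComps p n k :=
    fun p n => perc_sum_compInd p n _
  have hdiff : ∀ n : ℕ, ∀ E ⊆ allPairs n,
      (sumCompSq E : ℝ) - (L1 E : ℝ) ^ 2 - smallSum n (fun k => k) E =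
        largeSum n E - (L1 E : ℝ) ^ 2 := fun n E hE => by
    rw [sumCompSq_eq_add hE]; ring
  refine exists_erExp_bounds hlam0 hc zero_le_one hdecay
    (K₁ := K₄ + K₃ / δ ^ 2 + (K₁ + K₂)) (K₂ := K₄ + |K₁ + K₂|)
    (fun n E => (sumCompSq E : ℝ) - (L1 E : ℝ) ^ 2) (fun E => by simp [sumCompSq, L1]) ?_ ?_
  · filter_upwards [h1, h2, h3, h4, hdom, eventually_le_mul_of_mul_self_le hκ0,
      Filter.eventually_ge_atTop ⌈lam⌉₊, Filter.eventually_gt_atTop 0]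
      with n h1 h2 h3 h4 ⟨m, hmn, hm⟩ hsq hn hn0
    have hn0' : (0 : ℝ) < n := by exact_mod_cast hn0
    have hp : 0 ≤ lam / n := by positivity
    have hp1 : lam / n ≤ 1 := (div_le_one hn0').2 (Nat.ceil_le.1 hn)
    have hmean := perc_smallSum_one_le hp hp1 hc hmn hsq hm
    have h5 := perc_allSmall_le hδ0 hn0 hp hp1 (by rwa [hδ, sub_sub_cancel]) h3
    have h6 : (n : ℝ)⁻¹ * ∑ k ∈ range (n + 1),
        sqrtTrunc n (fun k => (k : ℝ) ^ (3 + 1)) k * expComps (lam / n) n k ≤ K₄ := by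
      rw [inv_mul_le_iff₀ hn0', mul_comm (n : ℝ)]
      exact h4
    refine (perc_mono hp hp1 fun E hE => ?_).trans (?_ : perc (lam / n) (allPairs n) (fun E =>
      (n : ℝ)⁻¹ * (∑ W : Finset (Fin n),
          sqrtTrunc n (fun k => (k : ℝ) ^ (3 + 1)) W.card * compInd W E) +
        n * allSmall n E + (n : ℝ) ^ 4 * (midCount κ n E + giantPairs κ n E)) ≤ _)
    · rw [hdiff n E hE]
      exact abs_largeSum_sub_sq_L1_le_add κ hn0 hE
    · rw [perc_add, perc_add, perc_const_mul, perc_const_mul, perc_const_mul, perc_add, hsum,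
        mul_add]
      exact add_le_add (add_le_add h6 h5) (add_le_add h1 h2)
  · filter_upwards [h1, h2, h4, Filter.eventually_ge_atTop ⌈lam⌉₊, Filter.eventually_gt_atTop 0]
      with n h1 h2 h4 hn hn0
    have hn1 : (1 : ℝ) ≤ n := by exact_mod_cast hn0
    have hp : 0 ≤ lam / n := by positivity
    have hp1 : lam / n ≤ 1 := (div_le_one (by linarith)).2 (Nat.ceil_le.1 hn)
    refine (perc_mono hp hp1 fun E hE => ?_).trans (?_ : perc (lam / n) (allPairs n) (fun E =>
      ∑ W : Finset (Fin n), sqrtTrunc n (fun k => (k : ℝ) ^ (3 + 1)) W.card * compInd W E +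
        (n : ℝ) ^ 4 * (midCount κ n E + giantPairs κ n E)) ≤ _)
    · rw [hdiff n E hE]
      exact sq_largeSum_sub_sq_L1_le κ hn0 hE
    · rw [perc_add, perc_const_mul, perc_add, hsum, mul_add, add_mul]
      refine add_le_add h4 ((add_le_add h1 h2).trans ?_)
      exact (le_abs_self _).trans (le_mul_of_one_le_right (abs_nonneg _) hn1)

/-- Lemma 2.4: susceptibility of `G(n, λ/n)`:
for `λ < 1`, `E[Σ_{j≥1} L_j²] = γ n + O(1)` and `Var[Σ_{j≥1} L_j²] = O(n)`;
for `λ > 1` the same holds for `Σ_{j≥2} L_j² = Σ_j L_j² - L₁²`. -/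
theorem er_susceptibility (lam : ℝ) (hlam : 0 < lam) :
    (lam < 1 → ∃ γ K : ℝ, 0 < γ ∧ 0 < K ∧ ∀ n : ℕ,
      |erExp n (lam / n) (fun E => (sumCompSq E : ℝ)) - γ * n| ≤ K ∧
      erExp n (lam / n) (fun E => ((sumCompSq E : ℝ)) ^ 2) -
          erExp n (lam / n) (fun E => (sumCompSq E : ℝ)) ^ 2 ≤ K * n) ∧
    (1 < lam → ∃ γ K : ℝ, 0 < γ ∧ 0 < K ∧ ∀ n : ℕ,
      |erExp n (lam / n) (fun E => (sumCompSq E : ℝ) - (L1 E : ℝ) ^ 2) - γ * n| ≤ K ∧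
      erExp n (lam / n) (fun E => ((sumCompSq E : ℝ) - (L1 E : ℝ) ^ 2) ^ 2) -
          erExp n (lam / n) (fun E => (sumCompSq E : ℝ) - (L1 E : ℝ) ^ 2) ^ 2 ≤ K * n) := by
  exact ⟨exists_bounds_of_lt_one hlam, exists_bounds_of_one_lt⟩
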